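/- arXiv:2011.14653 — 12 statements merged into one kernel-verified Lean document; each statement's English description precedes it below -/
import Mathlib

section
/- Let d > 1 be a real number and n ≥ 1 an integer with (n+1)^d ≥ 1 + 2/ln 2. Let H > 0 and assume that pr(x) − x < H·(ln x)² for every real x ≥ 2. Let (c_j)_{j≥0} be a sequence of real numbers such that c_0 ≥ 2, c_0^{n^d} is a prime number, and for each j ≥ 0: if ⌊c_j^{(n+j+1)^d}⌋ is prime then c_{j+1} = c_j, and otherwise c_{j+1} = pr(c_j^{(n+j+1)^d})^{1/(n+j+1)^d}. Then the sequence (c_j) is nondecreasing, satisfies c_j < c_0 + 2H·(ln 2)²·∑_{k=1}^{j} (n+k)^d / 2^{(n+k)^d} for every j ≥ 1, and converges to a finite limit. -/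
open Real Filter

/-- `pr x` is the smallest prime number strictly greater than `x`. -/
noncomputable def pr (x : ℝ) : ℕ := sInf {p : ℕ | p.Prime ∧ x < (p : ℝ)}

lemma pr_gt (x : ℝ) : x < (pr x : ℝ) := by
  have hne : {p : ℕ | p.Prime ∧ x < (p : ℝ)}.Nonempty := by
    obtain ⟨p, hp, hpp⟩ := Nat.exists_infinite_primes (⌊x⌋₊ + 1)
    refine ⟨p, hpp, ?_⟩
    have h1 := Nat.lt_floor_add_one x
    have h2 : ((⌊x⌋₊ + 1 : ℕ) : ℝ) ≤ p := by exact_mod_cast hp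
    push_cast at h2
    linarith
  exact (Nat.sInf_mem hne).2

lemma key_log (c e : ℝ) (hc : 2 ≤ c) (he : 1 + 2 / Real.log 2 ≤ e) :
    (Real.log c) ^ 2 / c ^ (e - 1) ≤ (Real.log 2) ^ 2 / 2 ^ (e - 1) := by
  have hl : 0 < Real.log 2 := Real.log_pos (by norm_num)
  have hq : 0 < 2 / Real.log 2 := by positivity
  have ha : 0 < (e - 1) / 2 := by linarith
  have h2 : Real.exp (1 / ((e - 1) / 2)) ≤ 2 := by
    rw [← Real.le_log_iff_exp_le (by norm_num), div_le_iff₀ ha]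
    have : 2 / Real.log 2 ≤ e - 1 := by linarith
    rw [div_le_iff₀ hl] at this
    linarith
  rw [one_div] at h2
  have h := Real.log_div_self_rpow_antitoneOn ha h2 (le_trans h2 hc) hc
  simp only at h
  have h0 : 0 ≤ Real.log c / c ^ ((e - 1) / 2) :=
    div_nonneg (Real.log_nonneg (by linarith)) (by positivity)
  have h3 := pow_le_pow_left₀ h0 h 2
  rw [div_pow, div_pow, ← Real.rpow_mul_natCast (by linarith), ← Real.rpow_mul_natCast (by norm_num)] at h3
  have : (e - 1) / 2 * ((2 : ℕ) : ℝ) = e - 1 := by push_cast; ring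
  rwa [this] at h3

lemma key_step (c e H p : ℝ) (hc : 2 ≤ c) (he : 1 + 2 / Real.log 2 ≤ e) (hH : 0 < H)
    (hp0 : 0 ≤ p) (hp : p < c ^ e + H * (Real.log (c ^ e)) ^ 2) :
    p ^ (1 / e) < c + 2 * H * (Real.log 2) ^ 2 * (e / 2 ^ e) := by
  have hl : 0 < Real.log 2 := Real.log_pos (by norm_num)
  have hq : 0 < 2 / Real.log 2 := by positivity
  have hcp : 0 < c := by linarith
  have he1 : 1 ≤ e := by linarith
  have he0 : 0 < e := by linarith
  have hk := key_log c e hc he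
  rw [Real.log_rpow hcp] at hp
  set δ := H * (e * Real.log c) ^ 2 / c ^ e with hδ
  have hce : 0 < c ^ e := by positivity
  have hδ0 : 0 ≤ δ := by positivity
  have hp' : p < c ^ e * (1 + δ) := by
    rw [hδ]; field_simp; linarith
  have h1 : p ^ (1 / e) < (c ^ e * (1 + δ)) ^ (1 / e) :=
    Real.rpow_lt_rpow hp0 hp' (by positivity)
  rw [Real.mul_rpow hce.le (by positivity), ← Real.rpow_mul hcp.le,
    mul_one_div_cancel he0.ne', Real.rpow_one] at h1
  have h2 : (1 + δ) ^ (1 / e) ≤ 1 + 1 / e * δ :=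
    rpow_one_add_le_one_add_mul_self (by linarith) (by positivity)
      ((div_le_one he0).2 he1)
  have h3 : c * (1 + 1 / e * δ) = c + H * e * ((Real.log c) ^ 2 / c ^ (e - 1)) := by
    rw [hδ, Real.rpow_sub_one hcp.ne']; field_simp
  have h4 : c + 2 * H * (Real.log 2) ^ 2 * (e / 2 ^ e)
      = c + H * e * ((Real.log 2) ^ 2 / 2 ^ (e - 1)) := by
    rw [Real.rpow_sub_one (by norm_num)]; field_simp
  rw [h4]
  calc p ^ (1 / e) < c * (1 + δ) ^ (1 / e) := h1
    _ ≤ c * (1 + 1 / e * δ) := by gcongr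
    _ = _ := h3
    _ ≤ _ := by gcongr

lemma term_le (y k : ℝ) (hk : 0 < k) (hy : k ≤ y) :
    y / 2 ^ y ≤ 6 / (Real.log 2) ^ 3 * (1 / k ^ 2) := by
  have hl : 0 < Real.log 2 := Real.log_pos (by norm_num)
  have hy0 : 0 < y := by linarith
  have h := Real.pow_div_factorial_le_exp (Real.log 2 * y) (by positivity) 3
  rw [← Real.rpow_def_of_pos (by norm_num)] at h
  norm_num [Nat.factorial] at h
  calc y / 2 ^ y ≤ y / ((Real.log 2 * y) ^ 3 / 6) := by gcongr
    _ = 6 / (Real.log 2) ^ 3 * (1 / y ^ 2) := by field_simp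
    _ ≤ _ := by gcongr




theorem stmt_0 (d : ℝ) (hd : 1 < d) (n : ℕ) (hn : 1 ≤ n)
    (hnd : ((n : ℝ) + 1) ^ d ≥ 1 + 2 / Real.log 2)
    (H : ℝ) (hH : 0 < H)
    (hCramer : ∀ x : ℝ, 2 ≤ x → (pr x : ℝ) - x < H * (Real.log x) ^ 2)
    (c : ℕ → ℝ) (hc0 : 2 ≤ c 0)
    (hc0prime : ∃ p : ℕ, p.Prime ∧ c 0 ^ ((n : ℝ) ^ d) = (p : ℝ))
    (hstep : ∀ j : ℕ,
      (Prime ⌊c j ^ (((n : ℝ) + j + 1) ^ d)⌋ → c (j + 1) = c j) ∧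
      (¬ Prime ⌊c j ^ (((n : ℝ) + j + 1) ^ d)⌋ →
        c (j + 1) = (pr (c j ^ (((n : ℝ) + j + 1) ^ d)) : ℝ) ^ (1 / (((n : ℝ) + j + 1) ^ d)))) :
    Monotone c ∧
    (∀ j : ℕ, 1 ≤ j →
      c j < c 0 + 2 * H * (Real.log 2) ^ 2 *
        ∑ k ∈ Finset.Icc 1 j, ((n : ℝ) + k) ^ d / (2 : ℝ) ^ (((n : ℝ) + k) ^ d)) ∧
    ∃ L : ℝ, Tendsto c atTop (nhds L) := by
  have hl : 0 < Real.log 2 := Real.log_pos (by norm_num)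
  have hq : 0 < 2 / Real.log 2 := by positivity
  have he : ∀ j : ℕ, 1 + 2 / Real.log 2 ≤ ((n : ℝ) + j + 1) ^ d := by
    intro j
    refine le_trans hnd ?_
    apply Real.rpow_le_rpow (by positivity) _ (by linarith)
    have : (0 : ℝ) ≤ j := by positivity
    linarith
  have hinc : ∀ j, 2 ≤ c j → c j ≤ c (j + 1) := by
    intro j hj
    have he0 : 0 < ((n : ℝ) + j + 1) ^ d := by positivity
    by_cases h : Prime ⌊c j ^ (((n : ℝ) + j + 1) ^ d)⌋
    · exact ((hstep j).1 h).ge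
    · rw [(hstep j).2 h]
      have h0 : (0 : ℝ) ≤ c j := by linarith
      have h1 := Real.rpow_le_rpow (z := 1 / (((n : ℝ) + j + 1) ^ d)) (by positivity)
        (pr_gt (c j ^ (((n : ℝ) + j + 1) ^ d))).le (by positivity)
      rwa [← Real.rpow_mul h0, mul_one_div_cancel he0.ne', Real.rpow_one] at h1
  have hge : ∀ j, 2 ≤ c j := by
    intro j
    induction j with
    | zero => exact hc0
    | succ j ih => exact ih.trans (hinc j ih)
  have hmono : Monotone c := monotone_nat_of_le_succ fun j => hinc j (hge j)
  have hs : ∀ j : ℕ, c (j + 1) < c j + 2 * H * (Real.log 2) ^ 2 *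
      (((n : ℝ) + j + 1) ^ d / 2 ^ (((n : ℝ) + j + 1) ^ d)) := by
    intro j
    by_cases h : Prime ⌊c j ^ (((n : ℝ) + j + 1) ^ d)⌋
    · rw [(hstep j).1 h]
      have : 0 < 2 * H * (Real.log 2) ^ 2 *
        (((n : ℝ) + j + 1) ^ d / 2 ^ (((n : ℝ) + j + 1) ^ d)) := by positivity
      linarith
    · rw [(hstep j).2 h]
      apply key_step _ _ _ _ (hge j) (he j) hH (by positivity)
      have hx : 2 ≤ c j ^ (((n : ℝ) + j + 1) ^ d) :=
        (hge j).trans (Real.self_le_rpow_of_one_le (by linarith [hge j]) (by linarith [he j]))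
      linarith [hCramer _ hx]
  have hbound : ∀ j : ℕ, 1 ≤ j →
      c j < c 0 + 2 * H * (Real.log 2) ^ 2 *
        ∑ k ∈ Finset.Icc 1 j, ((n : ℝ) + k) ^ d / (2 : ℝ) ^ (((n : ℝ) + k) ^ d) := by
    intro j hj
    induction j, hj using Nat.le_induction with
    | base =>
      have := hs 0
      simpa using this
    | succ j hj ih =>
      rw [Finset.sum_Icc_succ_top (by omega), mul_add]
      have := hs j
      push_cast
      rw [← add_assoc (n : ℝ)]
      linarith
  refine ⟨hmono, hbound, ?_⟩
  have hsum : Summable (fun k : ℕ => 6 / (Real.log 2) ^ 3 * (1 / (k : ℝ) ^ 2)) :=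
    (Real.summable_one_div_nat_pow.2 (by norm_num)).mul_left _
  have hB : ∀ j : ℕ, c (j + 1) ≤ c 0 + 2 * H * (Real.log 2) ^ 2 *
      ∑' k : ℕ, 6 / (Real.log 2) ^ 3 * (1 / (k : ℝ) ^ 2) := by
    intro j
    refine (hbound (j + 1) (by omega)).le.trans ?_
    gcongr
    refine le_trans (Finset.sum_le_sum ?_)
      (hsum.sum_le_tsum (Finset.Icc 1 (j + 1)) (fun k _ => by positivity))
    intro k hk
    have hk1 : (1 : ℝ) ≤ k := by exact_mod_cast (Finset.mem_Icc.1 hk).1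
    have hn0 : (0 : ℝ) ≤ n := by positivity
    apply term_le _ _ (by linarith)
    have := Real.self_le_rpow_of_one_le (x := (n : ℝ) + k) (by linarith) hd.le
    linarith
  refine ⟨⨆ j, c j, tendsto_atTop_ciSup hmono ⟨c 0 + 2 * H * (Real.log 2) ^ 2 *
      ∑' k : ℕ, 6 / (Real.log 2) ^ 3 * (1 / (k : ℝ) ^ 2), ?_⟩⟩
  rintro _ ⟨j, rfl⟩
  exact (hmono (Nat.le_succ j)).trans (hB j)
end

section
/- Let d > 1 be a real number, n ≥ 1 an integer with (n+1)^d ≥ 1 + 2/ln 2, and H > 0. Let (c_j)_{j≥0} be a nondecreasing sequence of real numbers with c_0 ≥ 2 satisfying, for every j ≥ 0, c_{j+1} ≤ c_j + H·(n+j+1)^d · c_j · (ln c_j)² / c_j^{(n+j+1)^d}. Then for every j ≥ 1, c_j ≤ c_0 + 2H·(ln 2)²·∑_{k=1}^{j} (n+k)^d / 2^{(n+k)^d}. -/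
open Real

lemma key_aux (x m : ℝ) (hx : 2 ≤ x) (hm : 1 + 2 / Real.log 2 ≤ m) :
    x * (Real.log x) ^ 2 / x ^ m ≤ 2 * (Real.log 2) ^ 2 / (2 : ℝ) ^ m := by
  have hx0 : 0 < x := by linarith
  have hl : 0 < Real.log 2 := Real.log_pos (by norm_num)
  have hL : Real.log 2 ≤ Real.log x := Real.log_le_log (by norm_num) hx
  rw [div_le_div_iff₀ (Real.rpow_pos_of_pos hx0 _) (Real.rpow_pos_of_pos (by norm_num) _)]
  rw [Real.rpow_def_of_pos hx0, Real.rpow_def_of_pos (by norm_num : (0:ℝ) < 2)]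
  have e1 : Real.exp (Real.log x) = x := Real.exp_log hx0
  have e2 : Real.exp (Real.log 2) = 2 := Real.exp_log (by norm_num)
  generalize Real.log x = L at *
  generalize Real.log 2 = l at *
  rw [← e1, ← e2]
  have h1 : L ≤ l * Real.exp ((L - l) / l) := by
    have := Real.add_one_le_exp ((L - l) / l)
    calc L = l * ((L - l) / l + 1) := by field_simp; ring
      _ ≤ _ := by gcongr
  have h2 : L ^ 2 ≤ l ^ 2 * Real.exp ((m - 1) * (L - l)) := by
    calc L ^ 2 ≤ (l * Real.exp ((L - l) / l)) ^ 2 := by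
          have : 0 ≤ L := by linarith
          gcongr
      _ = l ^ 2 * Real.exp (2 / l * (L - l)) := by
          rw [mul_pow, ← Real.exp_nat_mul]; congr 2; push_cast; ring
      _ ≤ _ := by
          have : 0 ≤ L - l := by linarith
          gcongr
          linarith
  calc Real.exp L * L ^ 2 * Real.exp (l * m)
      ≤ Real.exp L * (l ^ 2 * Real.exp ((m - 1) * (L - l))) * Real.exp (l * m) := by gcongr
    _ = l ^ 2 * Real.exp (L + (m - 1) * (L - l) + l * m) := by
        rw [Real.exp_add, Real.exp_add]; ring
    _ = l ^ 2 * Real.exp (l + L * m) := by congr 2; ring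
    _ = _ := by rw [Real.exp_add]; ring

theorem stmt_1 (d : ℝ) (hd : 1 < d) (n : ℕ) (hn : 1 ≤ n)
    (hnd : ((n : ℝ) + 1) ^ d ≥ 1 + 2 / Real.log 2)
    (H : ℝ) (hH : 0 < H)
    (c : ℕ → ℝ) (hmono : Monotone c) (hc0 : 2 ≤ c 0)
    (hstep : ∀ j : ℕ,
      c (j + 1) ≤ c j + H * ((n : ℝ) + j + 1) ^ d * c j * (Real.log (c j)) ^ 2 /
        (c j) ^ (((n : ℝ) + j + 1) ^ d)) :
    ∀ j : ℕ, 1 ≤ j →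
      c j ≤ c 0 + 2 * H * (Real.log 2) ^ 2 *
        ∑ k ∈ Finset.Icc 1 j, ((n : ℝ) + k) ^ d / (2 : ℝ) ^ (((n : ℝ) + k) ^ d) := by
  intro j _
  induction j with
  | zero => simp
  | succ j ih =>
    have ih' : c j ≤ c 0 + 2 * H * (Real.log 2) ^ 2 *
        ∑ k ∈ Finset.Icc 1 j, ((n : ℝ) + k) ^ d / (2 : ℝ) ^ (((n : ℝ) + k) ^ d) := by
      rcases Nat.eq_zero_or_pos j with h | h
      · subst h; simp
      · exact ih h
    rw [Finset.sum_Icc_succ_top (by omega)]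
    have hm : ((n : ℝ) + 1) ^ d ≤ ((n : ℝ) + j + 1) ^ d := by
      have : (0:ℝ) ≤ j := Nat.cast_nonneg j
      apply Real.rpow_le_rpow <;> first | positivity | linarith
    have hs := hstep j
    have e : ((n : ℝ) + ((j + 1 : ℕ) : ℝ)) = (n : ℝ) + j + 1 := by push_cast; ring
    rw [e]
    have k := key_aux (c j) (((n : ℝ) + j + 1) ^ d) (hc0.trans (hmono (Nat.zero_le j)))
      (le_trans hnd hm)
    have hp : 0 ≤ H * ((n : ℝ) + j + 1) ^ d := by positivity
    generalize ((n : ℝ) + j + 1) ^ d = m at *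
    have k2 := mul_le_mul_of_nonneg_left k hp
    have e3 : H * m * c j * (Real.log (c j)) ^ 2 / (c j) ^ m
      = H * m * (c j * (Real.log (c j)) ^ 2 / (c j) ^ m) := by ring
    have e4 : H * m * (2 * (Real.log 2) ^ 2 / (2 : ℝ) ^ m)
      = 2 * H * (Real.log 2) ^ 2 * (m / (2 : ℝ) ^ m) := by ring
    rw [e3] at hs
    rw [e4] at k2
    rw [mul_add]
    linarith
end

section
/- Assume that pr(x) − x < (ln x)² for every real x ≥ 11. Then there exists a real constant d with 1.7355149500 < d < 1.7355149501 such that for every integer n ≥ 0 the number 1 + ⌊2^{n^d}⌋ is prime, and the map n ↦ 1 + ⌊2^{n^d}⌋ is strictly increasing on n ≥ 0 (so these primes are pairwise distinct). -/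
open Real

def pmod (N a : ℕ) : ℕ → ℕ → ℕ
  | 0, _ => 1
  | f + 1, e => (pmod N a f (e / 2)) ^ 2 % N * (bif Nat.beq (e % 2) 1 then a else 1) % N

lemma pmod_spec (N a : ℕ) : ∀ f e, e < 2 ^ f → (pmod N a f e) ≡ a ^ e [MOD N] := by
  intro f
  induction f with
  | zero => intro e he; simp at he; subst he; exact Nat.ModEq.refl _
  | succ f ih =>
    intro e he
    have h2 : e / 2 < 2 ^ f := by rw [pow_succ] at he; omega
    have h := ih (e / 2) h2
    unfold pmod
    refine (Nat.mod_modEq _ _).trans ?_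
    have key : a ^ e = (a ^ (e / 2)) ^ 2 * (bif Nat.beq (e % 2) 1 then a else 1) := by
      rcases Nat.mod_two_eq_zero_or_one e with h0 | h0
      · rw [h0]
        have : e = (e / 2) * 2 := by omega
        conv_lhs => rw [this, pow_mul]
        exact (mul_one _).symm
      · rw [h0]
        have : e = (e / 2) * 2 + 1 := by omega
        conv_lhs => rw [this, pow_succ, pow_mul]
        rfl
    rw [key]
    exact Nat.ModEq.mul ((Nat.mod_modEq _ _).trans (h.pow 2)) rfl

lemma dvd_of_no_drop {o M F : ℕ} (hM : M ≠ 0) (hF : F ∣ M) (ho : o ∣ M)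
    (h : ∀ q, q.Prime → q ∣ F → ¬ o ∣ M / q) : F ∣ o := by
  have hF0 : F ≠ 0 := by rintro rfl; exact hM (zero_dvd_iff.1 hF)
  have ho0 : o ≠ 0 := by rintro rfl; exact hM (zero_dvd_iff.1 ho)
  rw [← Nat.factorization_prime_le_iff_dvd hF0 ho0]
  intro q hq
  by_cases hqF : q ∣ F
  · obtain ⟨c, hc⟩ := ho
    have hc0 : c ≠ 0 := by rintro rfl; simp at hc; exact hM hc
    have hqc : ¬ q ∣ c := by
      rintro ⟨e, rfl⟩
      apply h q hq hqF
      refine ⟨e, ?_⟩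
      rw [hc, show o * (q * e) = q * (o * e) by ring, Nat.mul_div_cancel_left _ hq.pos]
    have h1 : F.factorization q ≤ M.factorization q :=
      (Nat.factorization_le_iff_dvd hF0 hM).2 hF q
    rw [hc, Nat.factorization_mul ho0 hc0, Finsupp.add_apply,
      Nat.factorization_eq_zero_of_not_dvd hqc] at h1
    simpa using h1
  · rw [Nat.factorization_eq_zero_of_not_dvd hqF]; exact Nat.zero_le _

def pockB (N a F f : ℕ) (qs : List ℕ) : Bool :=
  Nat.blt 1 N && Nat.beq ((N - 1) % F) 0 && Nat.blt N (F * F) && Nat.blt (N - 1) (2 ^ f) &&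
  Nat.beq (qs.prod ^ 8 % F) 0 && Nat.beq (pmod N a f (N - 1)) 1 &&
  qs.all (fun q => Nat.beq (Nat.gcd (pmod N a f ((N - 1) / q) + (N - 1)) N) 1)

theorem pock (N a F f : ℕ) (qs : List ℕ) (hq : ∀ q ∈ qs, q.Prime) (h : pockB N a F f qs = true) :
    N.Prime := by
  simp only [pockB, Bool.and_eq_true, Nat.beq_eq, Nat.blt_eq, List.all_eq_true] at h
  obtain ⟨⟨⟨⟨⟨⟨hN, hF⟩, hFN⟩, hf⟩, hprod⟩, h1⟩, h2⟩ := h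
  by_contra hnp
  set p := N.minFac with hp
  have hpp : p.Prime := Nat.minFac_prime (by omega)
  have : Fact p.Prime := ⟨hpp⟩
  have hpN : p ∣ N := Nat.minFac_dvd N
  have hsq : p ^ 2 ≤ N := Nat.minFac_sq_le_self (by omega) hnp
  have hcast : ∀ e, e ≤ N - 1 → ((pmod N a f e : ℕ) : ZMod p) = (a : ZMod p) ^ e := by
    intro e he
    have := (pmod_spec N a f e (by omega)).of_dvd hpN
    have := (ZMod.natCast_eq_natCast_iff _ _ _).2 this
    simpa using this
  have hx : (a : ZMod p) ^ (N - 1) = 1 := by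
    rw [← hcast _ le_rfl, h1]; simp
  have hx0 : (a : ZMod p) ≠ 0 := by
    intro h0; rw [h0, zero_pow (by omega)] at hx; exact zero_ne_one hx
  have hFd : F ∣ orderOf (a : ZMod p) := by
    apply dvd_of_no_drop (M := N - 1) (by omega) (Nat.dvd_of_mod_eq_zero hF)
      (orderOf_dvd_of_pow_eq_one hx)
    intro q hqp hqF ho
    have hqm : q ∈ qs := by
      have : q ∣ qs.prod ^ 8 := hqF.trans (Nat.dvd_of_mod_eq_zero hprod)
      have := hqp.dvd_of_dvd_pow this
      obtain ⟨r, hr, hqr⟩ := (hqp.prime.dvd_prod_iff).1 this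
      rwa [(Nat.prime_dvd_prime_iff_eq hqp (hq r hr)).1 hqr]
    have hone : (a : ZMod p) ^ ((N - 1) / q) = 1 := orderOf_dvd_iff_pow_eq_one.1 ho
    rw [← hcast _ (Nat.div_le_self _ _)] at hone
    have hg := h2 q hqm
    have hd : p ∣ pmod N a f ((N - 1) / q) + (N - 1) := by
      rw [← ZMod.natCast_eq_zero_iff]
      push_cast [hone]
      have : ((1 + (N - 1) : ℕ) : ZMod p) = 0 := by
        rw [ZMod.natCast_eq_zero_iff]; rwa [show 1 + (N - 1) = N by omega]
      simpa using this
    have := Nat.dvd_gcd hd hpN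
    rw [hg] at this
    exact hpp.one_lt.ne' (Nat.dvd_one.1 this)
  have hle : F ≤ p - 1 := Nat.le_of_dvd (by have := hpp.two_le; omega)
    (hFd.trans (ZMod.orderOf_dvd_card_sub_one hx0))
  have : F * F ≤ p ^ 2 := by rw [pow_two]; exact Nat.mul_le_mul (by omega) (by omega)
  omega
def hl (S T : ℕ) : ℕ → ℕ → ℕ
  | 0, _ => 0
  | n + 1, i => S / (2 * i + 1) + T * hl S T n (i + 1) / S

def hu (S T : ℕ) : ℕ → ℕ → ℕ
  | 0, _ => 2 * S
  | n + 1, i => (S / (2 * i + 1) + 1) + (T * hu S T n (i + 1) / S + 1)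

lemma div_le_natdiv (a b : ℕ) : (a : ℝ) / b ≤ ((a / b : ℕ) : ℝ) + 1 := by
  have := (Nat.lt_floor_add_one ((a : ℝ) / b)).le
  rwa [Nat.floor_div_eq_div] at this

lemma hl_le (S T : ℕ) (hS : 0 < S) (y : ℝ) (hy : 0 ≤ y) (hT : (T : ℝ) ≤ S * y) : ∀ n i : ℕ,
    (hl S T n i : ℝ) ≤ S * ∑ j ∈ Finset.range n, y ^ j / (2 * ((i : ℝ) + j) + 1) := by
  intro n
  have hS' : (0 : ℝ) < S := by exact_mod_cast hS
  induction n with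
  | zero => intro i; simp [hl]
  | succ n ih =>
    intro i
    rw [Finset.sum_range_succ']
    unfold hl
    have h1 : ((S / (2 * i + 1) : ℕ) : ℝ) ≤ S / (2 * i + 1) := by
      simpa using (Nat.cast_div_le (α := ℝ) (m := S) (n := 2 * i + 1))
    have h2 : ((T * hl S T n (i + 1) / S : ℕ) : ℝ) ≤ T * hl S T n (i + 1) / S := by
      simpa using (Nat.cast_div_le (α := ℝ) (m := T * hl S T n (i + 1)) (n := S))
    have h3 := ih (i + 1)
    have h4 : (T : ℝ) * hl S T n (i + 1) / S ≤
        S * ∑ j ∈ Finset.range n, y ^ (j + 1) / (2 * ((i : ℝ) + (j + 1 : ℕ)) + 1) := by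
      rw [div_le_iff₀ hS']
      calc (T : ℝ) * hl S T n (i + 1) ≤ (S * y) *
            (S * ∑ j ∈ Finset.range n, y ^ j / (2 * (((i + 1 : ℕ) : ℝ) + j) + 1)) := by
              gcongr
        _ = _ := by
          rw [Finset.mul_sum, Finset.mul_sum, Finset.mul_sum, Finset.sum_mul]
          refine Finset.sum_congr rfl fun j _ => ?_
          push_cast
          rw [show (i : ℝ) + 1 + j = i + (j + 1) by ring]
          ring
    push_cast at *
    have h5 : (S : ℝ) / (2 * i + 1) = S * (y ^ 0 / (2 * ((i : ℝ) + 0) + 1)) := by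
      simp [div_eq_mul_inv]
    rw [mul_add, ← h5]
    linarith

lemma le_hu (S T : ℕ) (hS : 0 < S) (y : ℝ) (hy : 0 ≤ y) (hT : S * y ≤ (T : ℝ)) : ∀ n i : ℕ,
    S * (∑ j ∈ Finset.range n, y ^ j / (2 * ((i : ℝ) + j) + 1) + 2 * y ^ n) ≤ (hu S T n i : ℝ) := by
  intro n
  have hS' : (0 : ℝ) < S := by exact_mod_cast hS
  induction n with
  | zero => intro i; simp [hu, mul_comm]
  | succ n ih =>
    intro i
    rw [Finset.sum_range_succ']
    unfold hu
    have h1 := div_le_natdiv S (2 * i + 1)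
    have h2 := div_le_natdiv (T * hu S T n (i + 1)) S
    have h3 := ih (i + 1)
    have h4 : S * (∑ j ∈ Finset.range n, y ^ (j + 1) / (2 * ((i : ℝ) + (j + 1 : ℕ)) + 1)
        + 2 * y ^ (n + 1)) ≤ (T : ℝ) * hu S T n (i + 1) / S := by
      rw [le_div_iff₀ hS']
      refine le_trans (le_of_eq ?_) (mul_le_mul hT h3 (by positivity) (by positivity))
      rw [mul_add, mul_add, mul_add, add_mul, Finset.mul_sum, Finset.mul_sum, Finset.mul_sum,
        Finset.sum_mul]
      congr 1
      · refine Finset.sum_congr rfl fun j _ => ?_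
        push_cast
        rw [show (i : ℝ) + 1 + j = i + (j + 1) by ring]
        ring
      · ring
    push_cast at *
    have h5 : (S : ℝ) / (2 * i + 1) = S * (y ^ 0 / (2 * ((i : ℝ) + 0) + 1)) := by
      simp [div_eq_mul_inv]
    rw [mul_add] at h4 ⊢
    rw [mul_add, ← h5]
    linarith

def al (S n u v : ℕ) : ℕ := (S * u / v) * hl S (S * (u * u) / (v * v)) n 0 / S
def au (S n u v : ℕ) : ℕ := (S * u / v + 1) * hu S (S * (u * u) / (v * v) + 1) n 0 / S + 1

lemma al_le (S n u v : ℕ) (hS : 0 < S) (huv : u < v) :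
    2 * (al S n u v : ℝ) ≤ S * Real.log (((v : ℝ) + u) / (v - u)) := by
  have hS' : (0 : ℝ) < S := by exact_mod_cast hS
  have hv : (0 : ℝ) < v := by exact_mod_cast (by omega : 0 < v)
  have huv' : (u : ℝ) < v := by exact_mod_cast huv
  have hx0 : (0 : ℝ) ≤ (u : ℝ) / v := by positivity
  have hx1 : (u : ℝ) / v < 1 := by rwa [div_lt_one hv]
  have hlog := Real.sum_range_le_log_div hx0 hx1 n
  have he : (1 + (u : ℝ) / v) / (1 - (u : ℝ) / v) = ((v : ℝ) + u) / (v - u) := by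
    have : (v : ℝ) - u ≠ 0 := by linarith
    field_simp
  rw [he] at hlog
  have hT : ((S * (u * u) / (v * v) : ℕ) : ℝ) ≤ S * ((u : ℝ) / v) ^ 2 := by
    refine (Nat.cast_div_le).trans (le_of_eq ?_)
    push_cast; field_simp
  have hh := hl_le S _ hS (((u : ℝ) / v) ^ 2) (by positivity) hT n 0
  have h1 : ((S * u / v : ℕ) : ℝ) ≤ S * ((u : ℝ) / v) := by
    refine (Nat.cast_div_le).trans (le_of_eq ?_)
    push_cast; field_simp
  have h2 : (al S n u v : ℝ) ≤ (S * u / v : ℕ) * (hl S (S * (u * u) / (v * v)) n 0 : ℕ) / S := by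
    unfold al
    refine (Nat.cast_div_le).trans (le_of_eq ?_)
    push_cast; rfl
  have h3 : (al S n u v : ℝ) ≤ S * ∑ i ∈ Finset.range n, ((u : ℝ) / v) ^ (2 * i + 1) / (2 * i + 1) := by
    refine h2.trans ?_
    rw [div_le_iff₀ hS']
    refine (mul_le_mul h1 hh (by positivity) (by positivity)).trans (le_of_eq ?_)
    rw [Finset.mul_sum, Finset.mul_sum, Finset.mul_sum, Finset.sum_mul]
    refine Finset.sum_congr rfl fun j _ => ?_
    push_cast
    rw [zero_add, ← pow_mul, pow_succ]
    ring
  have h4 := mul_le_mul_of_nonneg_left hlog hS'.le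
  linarith

lemma le_au (S n u v : ℕ) (hS : 0 < S) (huv : 2 * u ≤ v) (hv0 : 0 < v) :
    S * Real.log (((v : ℝ) + u) / (v - u)) ≤ 2 * (au S n u v : ℝ) := by
  have hS' : (0 : ℝ) < S := by exact_mod_cast hS
  have hv : (0 : ℝ) < v := by exact_mod_cast hv0
  have huv' : 2 * (u : ℝ) ≤ v := by exact_mod_cast huv
  have hx0 : (0 : ℝ) ≤ (u : ℝ) / v := by positivity
  have hx2 : (u : ℝ) / v ≤ 1 / 2 := by rw [div_le_iff₀ hv]; linarith
  have hx1 : (u : ℝ) / v < 1 := by linarith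
  have hlog := Real.log_div_le_sum_range_add hx0 hx1 n
  have he : (1 + (u : ℝ) / v) / (1 - (u : ℝ) / v) = ((v : ℝ) + u) / (v - u) := by
    have : (v : ℝ) - u ≠ 0 := by linarith
    field_simp
  rw [he] at hlog
  have hT : S * ((u : ℝ) / v) ^ 2 ≤ ((S * (u * u) / (v * v) + 1 : ℕ) : ℝ) := by
    push_cast
    refine le_trans (le_of_eq ?_) (div_le_natdiv _ _)
    push_cast; field_simp
  have hh := le_hu S _ hS (((u : ℝ) / v) ^ 2) (by positivity) hT n 0
  have h1 : S * ((u : ℝ) / v) ≤ ((S * u / v + 1 : ℕ) : ℝ) := by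
    push_cast
    refine le_trans (le_of_eq ?_) (div_le_natdiv _ _)
    push_cast; field_simp
  have h2 : ((S * u / v + 1 : ℕ) : ℝ) * (hu S (S * (u * u) / (v * v) + 1) n 0 : ℕ) / S
      ≤ (au S n u v : ℝ) := by
    unfold au
    have := div_le_natdiv ((S * u / v + 1) * hu S (S * (u * u) / (v * v) + 1) n 0) S
    rw [Nat.cast_mul] at this
    refine this.trans (le_of_eq ?_)
    rw [Nat.cast_add (_ / _) 1, Nat.cast_one]
  have h3 : S * (∑ i ∈ Finset.range n, ((u : ℝ) / v) ^ (2 * i + 1) / (2 * i + 1)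
      + 2 * ((u : ℝ) / v) ^ (2 * n + 1)) ≤ (au S n u v : ℝ) := by
    refine le_trans ?_ h2
    rw [le_div_iff₀ hS']
    refine le_trans (le_of_eq ?_) (mul_le_mul h1 hh (by positivity) (by positivity))
    rw [mul_add, mul_add, mul_add, add_mul, Finset.mul_sum, Finset.mul_sum, Finset.mul_sum,
      Finset.sum_mul]
    congr 1
    · refine Finset.sum_congr rfl fun j _ => ?_
      push_cast
      rw [zero_add, ← pow_mul, pow_succ]
      ring
    · rw [← pow_mul, pow_succ]; ring
  have h5 : ((u : ℝ) / v) ^ (2 * n + 1) / (1 - ((u : ℝ) / v) ^ 2) ≤ 2 * ((u : ℝ) / v) ^ (2 * n + 1) := by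
    rw [div_le_iff₀ (by nlinarith)]
    have : 0 ≤ ((u : ℝ) / v) ^ (2 * n + 1) := by positivity
    have h6 : ((u : ℝ) / v) ^ 2 ≤ 1 / 2 := by nlinarith
    nlinarith [mul_le_mul_of_nonneg_left h6 this]
  have h4 := mul_le_mul_of_nonneg_left (hlog.trans (add_le_add_right h5 _)) hS'.le
  linarith
def ml : ℕ → ℕ → ℕ
  | 0, _ => 0
  | f + 1, q => bif Nat.blt q 2 then 0 else ml f (q / 2) + 1

def LOm (S n a b m : ℕ) : ℕ := m * (2 * al S n 1 3) + 2 * al S n (a - 2 ^ m * b) (a + 2 ^ m * b)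
def HIm (S n a b m : ℕ) : ℕ := m * (2 * au S n 1 3) + 2 * au S n (a - 2 ^ m * b) (a + 2 ^ m * b)

lemma log_split (a b m : ℕ) (hb : 0 < b) (h : 2 ^ m * b ≤ a) :
    Real.log ((a : ℝ) / b) = m * Real.log 2 +
      Real.log ((((a + 2 ^ m * b : ℕ) : ℝ) + (a - 2 ^ m * b : ℕ)) /
        (((a + 2 ^ m * b : ℕ) : ℝ) - (a - 2 ^ m * b : ℕ))) := by
  have hb' : (0 : ℝ) < b := by exact_mod_cast hb
  have ha : (0 : ℝ) < a := by
    have : 0 < a := lt_of_lt_of_le (by positivity) h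
    exact_mod_cast this
  rw [Nat.cast_sub h]
  push_cast
  rw [← Real.log_pow, ← Real.log_mul (by positivity)]
  · congr 1
    have : (a : ℝ) + 2 ^ m * b - (a - 2 ^ m * b) = 2 * (2 ^ m * b) := by ring
    rw [this]
    field_simp
    ring
  · have : (a : ℝ) + 2 ^ m * b - (a - 2 ^ m * b) = 2 * (2 ^ m * b) := by ring
    rw [this, show (a : ℝ) + 2 ^ m * b + (a - 2 ^ m * b) = 2 * a by ring]
    positivity

lemma LOm_le (S n a b m : ℕ) (hS : 0 < S) (hb : 0 < b) (h : 2 ^ m * b ≤ a) :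
    (LOm S n a b m : ℝ) ≤ S * Real.log ((a : ℝ) / b) := by
  rw [log_split a b m hb h]
  have hp : 0 < 2 ^ m * b := by positivity
  have h1 := al_le S n (a - 2 ^ m * b) (a + 2 ^ m * b) hS (by omega)
  have h2 := al_le S n 1 3 hS (by omega)
  norm_num at h2
  unfold LOm
  have h3 := mul_le_mul_of_nonneg_left h2 (Nat.cast_nonneg (α := ℝ) m)
  rw [mul_add]
  rw [Nat.cast_add, Nat.cast_mul, Nat.cast_mul 2 (al _ _ _ _), Nat.cast_mul 2 (al _ _ _ _)]
  rw [Nat.cast_ofNat]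
  linarith

lemma le_HIm (S n a b m : ℕ) (hS : 0 < S) (hb : 0 < b) (h : 2 ^ m * b ≤ a)
    (h' : a ≤ 3 * (2 ^ m * b)) :
    S * Real.log ((a : ℝ) / b) ≤ (HIm S n a b m : ℝ) := by
  rw [log_split a b m hb h]
  have hp : 0 < 2 ^ m * b := by positivity
  have h1 := le_au S n (a - 2 ^ m * b) (a + 2 ^ m * b) hS (by omega) (by omega)
  have h2 := le_au S n 1 3 hS (by omega) (by omega)
  norm_num at h2
  unfold HIm
  have h3 := mul_le_mul_of_nonneg_left h2 (Nat.cast_nonneg (α := ℝ) m)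
  rw [mul_add]
  have h4 : ((m * (2 * au S n 1 3) + 2 * au S n (a - 2 ^ m * b) (a + 2 ^ m * b) : ℕ) : ℝ) =
      m * (2 * (au S n 1 3 : ℝ)) + 2 * (au S n (a - 2 ^ m * b) (a + 2 ^ m * b) : ℝ) := by
    push_cast; rfl
  rw [h4]
  linarith

def okB (a b m : ℕ) : Bool := Nat.blt 0 b && Nat.ble (2 ^ m * b) a && Nat.ble a (3 * (2 ^ m * b))

noncomputable def FF (n : ℕ) (d : ℝ) : ℝ := (2 : ℝ) ^ ((n : ℝ) ^ d)

def geC (S n k An Ad u D c m1 m2 m3 : ℕ) : Bool :=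
  Nat.blt 0 S && Nat.blt 0 Ad && okB k 1 m1 && okB u D m2 && okB c 1 m3 &&
  Nat.ble (Ad * HIm S n u D m2) (An * LOm S n k 1 m1) &&
  Nat.ble (D * HIm S n c 1 m3) (u * LOm S n 2 1 0)

def leC (S n k An Ad u D c m1 m2 m3 : ℕ) : Bool :=
  Nat.blt 0 S && Nat.blt 0 Ad && okB k 1 m1 && okB u D m2 && okB c 1 m3 &&
  Nat.ble (An * HIm S n k 1 m1) (Ad * LOm S n u D m2) &&
  Nat.ble (u * HIm S n 2 1 0) (D * LOm S n c 1 m3)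

lemma FF_ge (S n k An Ad u D c m1 m2 m3 : ℕ) (h : geC S n k An Ad u D c m1 m2 m3 = true) :
    (c : ℝ) ≤ FF k ((An : ℝ) / Ad) := by
  simp only [geC, okB, Bool.and_eq_true, Nat.blt_eq, Nat.ble_eq] at h
  obtain ⟨⟨⟨⟨⟨⟨hS, hAd⟩, ⟨-, h1⟩, h1'⟩, ⟨hD, h2⟩, h2'⟩, ⟨-, h3⟩, h3'⟩, hA⟩, hB⟩ := h
  have a1 := LOm_le S n k 1 m1 hS one_pos h1
  have a2 := le_HIm S n u D m2 hS hD h2 h2'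
  have a3 := le_HIm S n c 1 m3 hS one_pos h3 h3'
  have a4 := LOm_le S n 2 1 0 hS one_pos (by norm_num)
  have hk : 0 < k := lt_of_lt_of_le (by positivity) h1
  have hu : 0 < u := lt_of_lt_of_le (by positivity) h2
  have hc : 0 < c := lt_of_lt_of_le (by positivity) h3
  have hS' : (0 : ℝ) < S := by exact_mod_cast hS
  have hAd' : (0 : ℝ) < Ad := by exact_mod_cast hAd
  have hD' : (0 : ℝ) < D := by exact_mod_cast hD
  have hk' : (0 : ℝ) < k := by exact_mod_cast hk
  have hu' : (0 : ℝ) < u := by exact_mod_cast hu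
  have hc' : (0 : ℝ) < c := by exact_mod_cast hc
  simp only [Nat.cast_one, div_one, Nat.cast_ofNat] at a1 a3 a4
  have hA' : (Ad : ℝ) * HIm S n u D m2 ≤ An * LOm S n k 1 m1 := by exact_mod_cast hA
  have hB' : (D : ℝ) * HIm S n c 1 m3 ≤ u * LOm S n 2 1 0 := by exact_mod_cast hB
  have b1 : Real.log ((u : ℝ) / D) ≤ Real.log k * ((An : ℝ) / Ad) := by
    rw [mul_div_assoc', le_div_iff₀ hAd']
    have := mul_le_mul_of_nonneg_left a2 hAd'.le
    have := mul_le_mul_of_nonneg_left a1 (Nat.cast_nonneg (α := ℝ) An)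
    refine le_of_mul_le_mul_left ?_ hS'
    linarith
  have b2 : Real.log c ≤ Real.log 2 * ((u : ℝ) / D) := by
    rw [mul_div_assoc', le_div_iff₀ hD']
    have := mul_le_mul_of_nonneg_left a3 hD'.le
    have := mul_le_mul_of_nonneg_left a4 hu'.le
    refine le_of_mul_le_mul_left ?_ hS'
    linarith
  have c1 : (u : ℝ) / D ≤ (k : ℝ) ^ ((An : ℝ) / Ad) := by
    rw [Real.rpow_def_of_pos hk', ← Real.log_le_iff_le_exp (by positivity)]
    exact b1
  have c2 : (c : ℝ) ≤ (2 : ℝ) ^ ((u : ℝ) / D) := by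
    rw [Real.rpow_def_of_pos two_pos, ← Real.log_le_iff_le_exp (by positivity)]
    exact b2
  exact c2.trans (Real.rpow_le_rpow_of_exponent_le one_le_two c1)

lemma FF_le (S n k An Ad u D c m1 m2 m3 : ℕ) (h : leC S n k An Ad u D c m1 m2 m3 = true) :
    FF k ((An : ℝ) / Ad) ≤ c := by
  simp only [leC, okB, Bool.and_eq_true, Nat.blt_eq, Nat.ble_eq] at h
  obtain ⟨⟨⟨⟨⟨⟨hS, hAd⟩, ⟨-, h1⟩, h1'⟩, ⟨hD, h2⟩, h2'⟩, ⟨-, h3⟩, h3'⟩, hA⟩, hB⟩ := h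
  have a1 := le_HIm S n k 1 m1 hS one_pos h1 h1'
  have a2 := LOm_le S n u D m2 hS hD h2
  have a3 := LOm_le S n c 1 m3 hS one_pos h3
  have a4 := le_HIm S n 2 1 0 hS one_pos (by norm_num) (by norm_num)
  have hk : 0 < k := lt_of_lt_of_le (by positivity) h1
  have hu : 0 < u := lt_of_lt_of_le (by positivity) h2
  have hc : 0 < c := lt_of_lt_of_le (by positivity) h3
  have hS' : (0 : ℝ) < S := by exact_mod_cast hS
  have hAd' : (0 : ℝ) < Ad := by exact_mod_cast hAd
  have hD' : (0 : ℝ) < D := by exact_mod_cast hD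
  have hk' : (0 : ℝ) < k := by exact_mod_cast hk
  have hu' : (0 : ℝ) < u := by exact_mod_cast hu
  have hc' : (0 : ℝ) < c := by exact_mod_cast hc
  simp only [Nat.cast_one, div_one, Nat.cast_ofNat] at a1 a3 a4
  have hA' : An * HIm S n k 1 m1 ≤ (Ad : ℝ) * LOm S n u D m2 := by exact_mod_cast hA
  have hB' : u * HIm S n 2 1 0 ≤ (D : ℝ) * LOm S n c 1 m3 := by exact_mod_cast hB
  have b1 : Real.log k * ((An : ℝ) / Ad) ≤ Real.log ((u : ℝ) / D) := by
    rw [mul_div_assoc', div_le_iff₀ hAd']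
    have := mul_le_mul_of_nonneg_left a2 hAd'.le
    have := mul_le_mul_of_nonneg_left a1 (Nat.cast_nonneg (α := ℝ) An)
    refine le_of_mul_le_mul_left ?_ hS'
    linarith
  have b2 : Real.log 2 * ((u : ℝ) / D) ≤ Real.log c := by
    rw [mul_div_assoc', div_le_iff₀ hD']
    have := mul_le_mul_of_nonneg_left a3 hD'.le
    have := mul_le_mul_of_nonneg_left a4 hu'.le
    refine le_of_mul_le_mul_left ?_ hS'
    linarith
  have c1 : (k : ℝ) ^ ((An : ℝ) / Ad) ≤ (u : ℝ) / D := by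
    rw [Real.rpow_def_of_pos hk', ← Real.le_log_iff_exp_le (by positivity)]
    exact b1
  have c2 : (2 : ℝ) ^ ((u : ℝ) / D) ≤ c := by
    rw [Real.rpow_def_of_pos two_pos, ← Real.le_log_iff_exp_le (by positivity)]
    exact b2
  exact (Real.rpow_le_rpow_of_exponent_le one_le_two c1).trans c2

def sS : ℕ := 2 ^ 256
def uGe (c : ℕ) : ℕ := sS * HIm sS 85 c 1 (ml 200 c) / LOm sS 85 2 1 0 + 1
def uLe (c : ℕ) : ℕ := sS * LOm sS 85 c 1 (ml 200 c) / HIm sS 85 2 1 0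
def geD (k An Ad c : ℕ) : Bool :=
  geC sS 85 k An Ad (uGe c) sS c (ml 200 k) (ml 200 (uGe c / sS)) (ml 200 c)
def leD (k An Ad c : ℕ) : Bool :=
  leC sS 85 k An Ad (uLe c) sS c (ml 200 k) (ml 200 (uLe c / sS)) (ml 200 c)
def cA : ℕ := 1735514950056347711712460729779409867246903164762649851737945645480007722
def cB : ℕ := 1735514950056347711712460729779409867246903164762649851739546574214151057
def cD : ℕ := 10 ^ 72

def pl : List ℕ := [2, 3, 11,
  107,
  2179,
  82567,
  5583143,
  655201697,
  130520191829,
  43329381532909,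
  23597530905732569,
  20797360055004437533,
  29308490383037012855557,
  65339739313566852003228833,
  228234725483467852137188220227,
  1238274126974162204059517412499259,
  10351929928150147135960184272165701017,
  132377628643754577920235170073534332488183,
  2571924449412791819519932061496968221601924629,
  75444021876761547680137323517065491114361208362073,
  3321792719527707037238020617492878023203447784270046843]
def pk (k : ℕ) : ℕ := pl.getD k 0

lemma chk_small : (List.range' 2 18).all (fun k => geD k cA cD (pk k - 1) && leD k cB cD (pk k)) = true := by
  decide +kernel

lemma chk_20 : (leD 20 cA cD (pk 20 - 1) && geD 20 cB cD (pk 20)) = true := by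
  decide +kernel

lemma pr_2 : Nat.Prime 2 := by norm_num

lemma pr_3 : Nat.Prime 3 := by norm_num

lemma pr_11 : Nat.Prime 11 := by norm_num

lemma pr_107 : Nat.Prime 107 := by norm_num

lemma pr_2179 : Nat.Prime 2179 := by norm_num

lemma pr_82567 : Nat.Prime 82567 :=
  pock _ 3 297 17 [3, 11]
    (by simp [pr_3, pr_11]) (by decide +kernel)

lemma pr_103 : Nat.Prime 103 := by norm_num

lemma pr_10301 : Nat.Prime 10301 :=
  pock _ 2 103 14 [103]
    (by simp [pr_103]) (by decide +kernel)

lemma pr_5583143 : Nat.Prime 5583143 :=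
  pock _ 2 10301 23 [10301]
    (by simp [pr_10301]) (by decide +kernel)

lemma pr_3041 : Nat.Prime 3041 := by norm_num

lemma pr_655201697 : Nat.Prime 655201697 :=
  pock _ 3 97312 30 [2, 3041]
    (by simp [pr_2, pr_3041]) (by decide +kernel)

lemma pr_40193 : Nat.Prime 40193 :=
  pock _ 3 256 16 [2]
    (by simp [pr_2]) (by decide +kernel)

lemma pr_80387 : Nat.Prime 80387 :=
  pock _ 2 40193 17 [40193]
    (by simp [pr_40193]) (by decide +kernel)

lemma pr_2510003689 : Nat.Prime 2510003689 :=
  pock _ 2 80387 32 [80387]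
    (by simp [pr_80387]) (by decide +kernel)

lemma pr_130520191829 : Nat.Prime 130520191829 :=
  pock _ 2 2510003689 37 [2510003689]
    (by simp [pr_2510003689]) (by decide +kernel)

lemma pr_229 : Nat.Prime 229 := by norm_num

lemma pr_5039 : Nat.Prime 5039 :=
  pock _ 2 229 13 [229]
    (by simp [pr_229]) (by decide +kernel)

lemma pr_10079 : Nat.Prime 10079 :=
  pock _ 2 5039 14 [5039]
    (by simp [pr_5039]) (by decide +kernel)

lemma pr_17839831 : Nat.Prime 17839831 :=
  pock _ 2 10079 25 [10079]
    (by simp [pr_10079]) (by decide +kernel)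

lemma pr_451347724301 : Nat.Prime 451347724301 :=
  pock _ 2 17839831 39 [17839831]
    (by simp [pr_17839831]) (by decide +kernel)

lemma pr_3610781794409 : Nat.Prime 3610781794409 :=
  pock _ 2 451347724301 42 [451347724301]
    (by simp [pr_451347724301]) (by decide +kernel)

lemma pr_43329381532909 : Nat.Prime 43329381532909 :=
  pock _ 2 3610781794409 46 [3610781794409]
    (by simp [pr_3610781794409]) (by decide +kernel)

lemma pr_5 : Nat.Prime 5 := by norm_num

lemma pr_7 : Nat.Prime 7 := by norm_num

lemma pr_13 : Nat.Prime 13 := by norm_num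

lemma pr_4635541 : Nat.Prime 4635541 :=
  pock _ 2 4095 23 [3, 5, 7, 13]
    (by simp [pr_3, pr_5, pr_7, pr_13]) (by decide +kernel)

lemma pr_268861379 : Nat.Prime 268861379 :=
  pock _ 2 4635541 29 [4635541]
    (by simp [pr_4635541]) (by decide +kernel)

lemma pr_23597530905732569 : Nat.Prime 23597530905732569 :=
  pock _ 2 268861379 55 [268861379]
    (by simp [pr_268861379]) (by decide +kernel)

lemma pr_17 : Nat.Prime 17 := by norm_num

lemma pr_446863 : Nat.Prime 446863 :=
  pock _ 3 1326 19 [2, 3, 13, 17]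
    (by simp [pr_2, pr_3, pr_13, pr_17]) (by decide +kernel)

lemma pr_159763353487 : Nat.Prime 159763353487 :=
  pock _ 2 446863 38 [446863]
    (by simp [pr_446863]) (by decide +kernel)

lemma pr_20797360055004437533 : Nat.Prime 20797360055004437533 :=
  pock _ 2 159763353487 65 [159763353487]
    (by simp [pr_159763353487]) (by decide +kernel)

lemma pr_613 : Nat.Prime 613 := by norm_num

lemma pr_5850473 : Nat.Prime 5850473 :=
  pock _ 3 4904 23 [2, 613]
    (by simp [pr_2, pr_613]) (by decide +kernel)

lemma pr_5607222033607 : Nat.Prime 5607222033607 :=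
  pock _ 2 5850473 43 [5850473]
    (by simp [pr_5850473]) (by decide +kernel)

lemma pr_29308490383037012855557 : Nat.Prime 29308490383037012855557 :=
  pock _ 2 5607222033607 75 [5607222033607]
    (by simp [pr_5607222033607]) (by decide +kernel)

lemma pr_53 : Nat.Prime 53 := by norm_num

lemma pr_83 : Nat.Prime 83 := by norm_num

lemma pr_127 : Nat.Prime 127 := by norm_num

lemma pr_53021231 : Nat.Prime 53021231 :=
  pock _ 2 10541 26 [83, 127]
    (by simp [pr_83, pr_127]) (by decide +kernel)

lemma pr_106042463 : Nat.Prime 106042463 :=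
  pock _ 2 53021231 27 [53021231]
    (by simp [pr_53021231]) (by decide +kernel)

lemma pr_212084927 : Nat.Prime 212084927 :=
  pock _ 2 106042463 28 [106042463]
    (by simp [pr_106042463]) (by decide +kernel)

lemma pr_65339739313566852003228833 : Nat.Prime 65339739313566852003228833 :=
  pock _ 3 43523220379232 86 [2, 11, 53, 212084927]
    (by simp [pr_2, pr_11, pr_53, pr_212084927]) (by decide +kernel)

lemma pr_41 : Nat.Prime 41 := by norm_num

lemma pr_260414617 : Nat.Prime 260414617 :=
  pock _ 3 22099 28 [7, 11, 41]
    (by simp [pr_7, pr_11, pr_41]) (by decide +kernel)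

lemma pr_348434757547 : Nat.Prime 348434757547 :=
  pock _ 2 260414617 39 [260414617]
    (by simp [pr_260414617]) (by decide +kernel)

lemma pr_11846781756599 : Nat.Prime 11846781756599 :=
  pock _ 2 348434757547 44 [348434757547]
    (by simp [pr_348434757547]) (by decide +kernel)

lemma pr_23693563513199 : Nat.Prime 23693563513199 :=
  pock _ 2 11846781756599 45 [11846781756599]
    (by simp [pr_11846781756599]) (by decide +kernel)

lemma pr_209774563863481481743739173 : Nat.Prime 209774563863481481743739173 :=
  pock _ 2 23693563513199 88 [23693563513199]
    (by simp [pr_23693563513199]) (by decide +kernel)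

lemma pr_114117362741733926068594110113 : Nat.Prime 114117362741733926068594110113 :=
  pock _ 2 209774563863481481743739173 97 [209774563863481481743739173]
    (by simp [pr_209774563863481481743739173]) (by decide +kernel)

lemma pr_228234725483467852137188220227 : Nat.Prime 228234725483467852137188220227 :=
  pock _ 2 114117362741733926068594110113 98 [114117362741733926068594110113]
    (by simp [pr_114117362741733926068594110113]) (by decide +kernel)

lemma pr_307 : Nat.Prime 307 := by norm_num

lemma pr_3613 : Nat.Prime 3613 := by norm_num

lemma pr_99810463399721 : Nat.Prime 99810463399721 :=
  pock _ 2 114246673 47 [103, 307, 3613]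
    (by simp [pr_103, pr_307, pr_3613]) (by decide +kernel)

lemma pr_9009982720628091968702767 : Nat.Prime 9009982720628091968702767 :=
  pock _ 2 99810463399721 83 [99810463399721]
    (by simp [pr_99810463399721]) (by decide +kernel)

lemma pr_1238274126974162204059517412499259 : Nat.Prime 1238274126974162204059517412499259 :=
  pock _ 2 9009982720628091968702767 110 [9009982720628091968702767]
    (by simp [pr_9009982720628091968702767]) (by decide +kernel)

lemma pr_769 : Nat.Prime 769 := by norm_num

lemma pr_7691 : Nat.Prime 7691 :=
  pock _ 2 769 13 [769]
    (by simp [pr_769]) (by decide +kernel)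

lemma pr_1319 : Nat.Prime 1319 := by norm_num

lemma pr_240059 : Nat.Prime 240059 :=
  pock _ 2 1319 18 [1319]
    (by simp [pr_1319]) (by decide +kernel)

lemma pr_5761417 : Nat.Prime 5761417 :=
  pock _ 2 240059 23 [240059]
    (by simp [pr_240059]) (by decide +kernel)

lemma pr_811 : Nat.Prime 811 := by norm_num

lemma pr_9733 : Nat.Prime 9733 :=
  pock _ 2 811 14 [811]
    (by simp [pr_811]) (by decide +kernel)

lemma pr_12068921 : Nat.Prime 12068921 :=
  pock _ 2 9733 24 [9733]
    (by simp [pr_9733]) (by decide +kernel)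

lemma pr_10351929928150147135960184272165701017 : Nat.Prime 10351929928150147135960184272165701017 :=
  pock _ 3 4278293281620395096 123 [2, 7691, 5761417, 12068921]
    (by simp [pr_2, pr_7691, pr_5761417, pr_12068921]) (by decide +kernel)

lemma pr_1627 : Nat.Prime 1627 := by norm_num

lemma pr_152939 : Nat.Prime 152939 :=
  pock _ 2 1627 18 [1627]
    (by simp [pr_1627]) (by decide +kernel)

lemma pr_4894049 : Nat.Prime 4894049 :=
  pock _ 2 152939 23 [152939]
    (by simp [pr_152939]) (by decide +kernel)

lemma pr_978809801 : Nat.Prime 978809801 :=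
  pock _ 2 4894049 30 [4894049]
    (by simp [pr_4894049]) (by decide +kernel)

lemma pr_801060442976251357 : Nat.Prime 801060442976251357 :=
  pock _ 2 978809801 60 [978809801]
    (by simp [pr_978809801]) (by decide +kernel)

lemma pr_140569904646931375179060383379601 : Nat.Prime 140569904646931375179060383379601 :=
  pock _ 2 801060442976251357 107 [801060442976251357]
    (by simp [pr_801060442976251357]) (by decide +kernel)

lemma pr_132377628643754577920235170073534332488183 : Nat.Prime 132377628643754577920235170073534332488183 :=
  pock _ 2 140569904646931375179060383379601 137 [140569904646931375179060383379601]
    (by simp [pr_140569904646931375179060383379601]) (by decide +kernel)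

lemma pr_10909 : Nat.Prime 10909 :=
  pock _ 2 108 14 [2, 3]
    (by simp [pr_2, pr_3]) (by decide +kernel)

lemma pr_1279 : Nat.Prime 1279 := by norm_num

lemma pr_12791 : Nat.Prime 12791 :=
  pock _ 2 1279 14 [1279]
    (by simp [pr_1279]) (by decide +kernel)

lemma pr_25583 : Nat.Prime 25583 :=
  pock _ 2 12791 15 [12791]
    (by simp [pr_12791]) (by decide +kernel)

lemma pr_12753957135432719 : Nat.Prime 12753957135432719 :=
  pock _ 2 279084947 54 [10909, 25583]
    (by simp [pr_10909, pr_25583]) (by decide +kernel)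

lemma pr_1147856142188944711 : Nat.Prime 1147856142188944711 :=
  pock _ 2 12753957135432719 60 [12753957135432719]
    (by simp [pr_12753957135432719]) (by decide +kernel)

lemma pr_519404904340497481727501 : Nat.Prime 519404904340497481727501 :=
  pock _ 2 1147856142188944711 79 [1147856142188944711]
    (by simp [pr_1147856142188944711]) (by decide +kernel)

lemma pr_301402443809154978571333083959171 : Nat.Prime 301402443809154978571333083959171 :=
  pock _ 2 519404904340497481727501 108 [519404904340497481727501]
    (by simp [pr_519404904340497481727501]) (by decide +kernel)

lemma pr_2571924449412791819519932061496968221601924629 : Nat.Prime 2571924449412791819519932061496968221601924629 :=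
  pock _ 2 301402443809154978571333083959171 151 [301402443809154978571333083959171]
    (by simp [pr_301402443809154978571333083959171]) (by decide +kernel)

lemma pr_23 : Nat.Prime 23 := by norm_num

lemma pr_2843 : Nat.Prime 2843 := by norm_num

lemma pr_1108771 : Nat.Prime 1108771 :=
  pock _ 2 2843 21 [2843]
    (by simp [pr_2843]) (by decide +kernel)

lemma pr_995346307918889 : Nat.Prime 995346307918889 :=
  pock _ 3 204013864 50 [2, 23, 1108771]
    (by simp [pr_2, pr_23, pr_1108771]) (by decide +kernel)

lemma pr_300959244046258873849597 : Nat.Prime 300959244046258873849597 :=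
  pock _ 2 995346307918889 78 [995346307918889]
    (by simp [pr_995346307918889]) (by decide +kernel)

lemma pr_1805755464277553243097583 : Nat.Prime 1805755464277553243097583 :=
  pock _ 2 300959244046258873849597 81 [300959244046258873849597]
    (by simp [pr_300959244046258873849597]) (by decide +kernel)

lemma pr_88943362990146523879647596090339 : Nat.Prime 88943362990146523879647596090339 :=
  pock _ 2 1805755464277553243097583 107 [1805755464277553243097583]
    (by simp [pr_1805755464277553243097583]) (by decide +kernel)

lemma pr_75444021876761547680137323517065491114361208362073 : Nat.Prime 75444021876761547680137323517065491114361208362073 :=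
  pock _ 2 88943362990146523879647596090339 166 [88943362990146523879647596090339]
    (by simp [pr_88943362990146523879647596090339]) (by decide +kernel)

lemma pr_59 : Nat.Prime 59 := by norm_num

lemma pr_347 : Nat.Prime 347 := by norm_num

lemma pr_599 : Nat.Prime 599 := by norm_num

lemma pr_17959 : Nat.Prime 17959 :=
  pock _ 6 246 15 [2, 3, 41]
    (by simp [pr_2, pr_3, pr_41]) (by decide +kernel)

lemma pr_148664603 : Nat.Prime 148664603 :=
  pock _ 2 17959 28 [17959]
    (by simp [pr_17959]) (by decide +kernel)

lemma pr_22620805992481 : Nat.Prime 22620805992481 :=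
  pock _ 2 148664603 45 [148664603]
    (by simp [pr_148664603]) (by decide +kernel)

lemma pr_53220173227930757421052448904790248501433 : Nat.Prime 53220173227930757421052448904790248501433 :=
  pock _ 2 277406340889354044287 136 [59, 347, 599, 22620805992481]
    (by simp [pr_59, pr_347, pr_599, pr_22620805992481]) (by decide +kernel)

lemma pr_3321792719527707037238020617492878023203447784270046843 : Nat.Prime 3321792719527707037238020617492878023203447784270046843 :=
  pock _ 2 53220173227930757421052448904790248501433 182 [53220173227930757421052448904790248501433]
    (by simp [pr_53220173227930757421052448904790248501433]) (by decide +kernel)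

lemma pk_prime : ∀ p ∈ pl, p.Prime := by
  simp only [pl, List.forall_mem_cons]
  exact ⟨pr_2, pr_3, pr_11, pr_107, pr_2179, pr_82567, pr_5583143, pr_655201697, pr_130520191829, pr_43329381532909, pr_23597530905732569, pr_20797360055004437533, pr_29308490383037012855557, pr_65339739313566852003228833, pr_228234725483467852137188220227, pr_1238274126974162204059517412499259, pr_10351929928150147135960184272165701017, pr_132377628643754577920235170073534332488183, pr_2571924449412791819519932061496968221601924629, pr_75444021876761547680137323517065491114361208362073, pr_3321792719527707037238020617492878023203447784270046843, by simp⟩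
lemma FF_inv (n : ℕ) (hn : 2 ≤ n) (y : ℝ) (hy : 1 < y) :
    FF n (Real.logb n (Real.logb 2 y)) = y := by
  have hn' : (2 : ℝ) ≤ n := by exact_mod_cast hn
  unfold FF
  rw [Real.rpow_logb (by linarith) (by linarith) (Real.logb_pos one_lt_two hy),
    Real.rpow_logb two_pos (by norm_num) (by linarith)]

lemma FF_lt (n : ℕ) (hn : 2 ≤ n) {a b : ℝ} (h : a < b) : FF n a < FF n b := by
  have hn' : (2 : ℝ) ≤ n := by exact_mod_cast hn
  unfold FF
  exact Real.rpow_lt_rpow_of_exponent_lt one_lt_two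
    (Real.rpow_lt_rpow_of_exponent_lt (by linarith) h)

lemma FF_mono (n : ℕ) (hn : 2 ≤ n) : StrictMono (FF n) := fun _ _ h => FF_lt n hn h

lemma FF_pos (n : ℕ) (a : ℝ) : 0 < FF n a := Real.rpow_pos_of_pos two_pos _

lemma pow_bound (n : ℕ) (hn : 20 ≤ n) (a : ℝ) (ha : 1.7355 ≤ a) :
    2 * Real.log (((n : ℝ) + 1) ^ a) ≤ Real.log 2 * (((n : ℝ) + 1) ^ a - (n : ℝ) ^ a) := by
  have hn' : (20 : ℝ) ≤ n := by exact_mod_cast hn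
  have hn0 : (0 : ℝ) < n := by linarith
  have hl2 := Real.log_two_gt_d9
  -- lower bound for the difference
  have h1 : a * (n : ℝ) ^ (a - 1) ≤ ((n : ℝ) + 1) ^ a - (n : ℝ) ^ a := by
    have hb := one_add_mul_self_le_rpow_one_add (s := 1 / (n : ℝ)) (p := a)
      (by have : (0 : ℝ) ≤ 1 / n := by positivity
          linarith) (by linarith)
    have e1 : ((n : ℝ) + 1) ^ a = (n : ℝ) ^ a * (1 + 1 / n) ^ a := by
      rw [← Real.mul_rpow hn0.le (by positivity)]
      congr 1
      field_simp
    rw [e1, Real.rpow_sub_one hn0.ne']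
    have := mul_le_mul_of_nonneg_left hb (Real.rpow_nonneg hn0.le a)
    have e2 : (n : ℝ) ^ a * (1 + a * (1 / n)) = (n : ℝ) ^ a + a * ((n : ℝ) ^ a / n) := by
      field_simp
    linarith
  set w := Real.log ((n : ℝ) / 20) with hw
  have hw0 : 0 ≤ w := Real.log_nonneg (by rw [le_div_iff₀ (by norm_num)]; linarith)
  have h20 : (9 : ℝ) ≤ (20 : ℝ) ^ (0.735 : ℝ) := by
    have : ((9 : ℝ) ^ 200) ≤ ((20 : ℝ) ^ (0.735 : ℝ)) ^ 200 := by
      rw [← Real.rpow_natCast ((20 : ℝ) ^ (0.735 : ℝ)), ← Real.rpow_mul (by norm_num)]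
      rw [show (0.735 : ℝ) * ((200 : ℕ) : ℝ) = ((147 : ℕ) : ℝ) by norm_num, Real.rpow_natCast]
      norm_num
    exact le_of_pow_le_pow_left₀ (by norm_num) (by positivity) this
  have h2 : 9 * (1 + 0.735 * w) ≤ (n : ℝ) ^ (a - 1) := by
    have e1 : (n : ℝ) ^ (0.735 : ℝ) = (20 : ℝ) ^ (0.735 : ℝ) * ((n : ℝ) / 20) ^ (0.735 : ℝ) := by
      rw [← Real.mul_rpow (by norm_num) (by positivity)]
      congr 1
      field_simp
    have e2 : 1 + 0.735 * w ≤ ((n : ℝ) / 20) ^ (0.735 : ℝ) := by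
      rw [Real.rpow_def_of_pos (by positivity)]
      have := Real.add_one_le_exp (w * 0.735)
      linarith
    calc 9 * (1 + 0.735 * w) ≤ (20 : ℝ) ^ (0.735 : ℝ) * ((n : ℝ) / 20) ^ (0.735 : ℝ) := by
          gcongr
      _ = (n : ℝ) ^ (0.735 : ℝ) := e1.symm
      _ ≤ _ := Real.rpow_le_rpow_of_exponent_le (by linarith) (by linarith)
  have h21 : Real.log 21 ≤ 3.05 := by
    have h3 : Real.log ((21 : ℝ) ^ 20) ≤ 61 := by
      rw [Real.log_le_iff_le_exp (by positivity)]
      have : Real.exp 61 = Real.exp 1 ^ 61 := by rw [← Real.exp_nat_mul]; norm_num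
      rw [this]
      calc (21 : ℝ) ^ 20 ≤ 2.7182818283 ^ 61 := by norm_num
        _ ≤ _ := by gcongr; exact Real.exp_one_gt_d9.le
    rw [Real.log_pow] at h3
    push_cast at h3
    linarith
  have h4 : Real.log ((n : ℝ) + 1) ≤ w + 3.05 := by
    have : Real.log ((n : ℝ) + 1) ≤ Real.log ((n : ℝ) / 20 * 21) :=
      Real.log_le_log (by positivity) (by linarith)
    rw [Real.log_mul (by positivity) (by norm_num)] at this
    linarith
  rw [Real.log_rpow (by positivity)]
  have ha0 : 0 < a := by linarith
  have h5 : 2 * (w + 3.05) ≤ Real.log 2 * (9 * (1 + 0.735 * w)) := by nlinarith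
  calc 2 * (a * Real.log ((n : ℝ) + 1)) ≤ a * (2 * (w + 3.05)) := by nlinarith
    _ ≤ a * (Real.log 2 * (9 * (1 + 0.735 * w))) := by gcongr
    _ = Real.log 2 * (a * (9 * (1 + 0.735 * w))) := by ring
    _ ≤ Real.log 2 * (a * (n : ℝ) ^ (a - 1)) := by gcongr
    _ ≤ _ := by gcongr

lemma growth (n : ℕ) (hn : 20 ≤ n) (a : ℝ) (ha : 1.7355 ≤ a) :
    1 + (Real.log (FF (n + 1) a + 1)) ^ 2 ≤ FF (n + 1) a / FF n a ∧ 11 ≤ FF (n + 1) a + 1 := by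
  have hn' : (20 : ℝ) ≤ n := by exact_mod_cast hn
  have hb := pow_bound n hn a ha
  unfold FF
  push_cast
  set X := ((n : ℝ) + 1) ^ a with hX
  have hX21 : 21 ≤ X := by
    calc (21 : ℝ) ≤ n + 1 := by linarith
      _ = ((n : ℝ) + 1) ^ (1 : ℝ) := (Real.rpow_one _).symm
      _ ≤ X := Real.rpow_le_rpow_of_exponent_le (by linarith) (by linarith)
  have hF1 : (16 : ℝ) ≤ 2 ^ X := by
    calc (16 : ℝ) = 2 ^ (4 : ℝ) := by norm_num
      _ ≤ _ := Real.rpow_le_rpow_of_exponent_le one_le_two (by linarith)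
  refine ⟨?_, by linarith⟩
  rw [← Real.rpow_sub two_pos]
  have h1 : X ^ 2 ≤ (2 : ℝ) ^ (X - (n : ℝ) ^ a) := by
    rw [Real.rpow_def_of_pos two_pos, ← Real.log_le_iff_le_exp (by positivity), Real.log_pow]
    exact_mod_cast hb
  refine le_trans ?_ h1
  have h2 : Real.log ((2 : ℝ) ^ X + 1) ≤ 0.6932 * (X + 1) := by
    have : Real.log ((2 : ℝ) ^ X + 1) ≤ Real.log ((2 : ℝ) ^ (X + 1)) := by
      apply Real.log_le_log (by positivity)
      rw [Real.rpow_add_one (by norm_num)]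
      linarith
    rw [Real.log_rpow two_pos] at this
    have h3 := Real.log_two_lt_d9
    nlinarith
  have h0 : 0 ≤ Real.log ((2 : ℝ) ^ X + 1) := Real.log_nonneg (by linarith)
  have : (Real.log ((2 : ℝ) ^ X + 1)) ^ 2 ≤ (0.6932 * (X + 1)) ^ 2 := by gcongr
  nlinarith

lemma ratio (n : ℕ) (hn : 2 ≤ n) {a b : ℝ} (ha : 0 < a) (hab : a < b) :
    FF n b / FF n a ≤ FF (n + 1) b / FF (n + 1) a := by
  have hn' : (2 : ℝ) ≤ n := by exact_mod_cast hn
  have hn0 : (0 : ℝ) < n := by linarith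
  unfold FF
  rw [← Real.rpow_sub two_pos, ← Real.rpow_sub two_pos]
  apply Real.rpow_le_rpow_of_exponent_le one_le_two
  push_cast
  have e (c : ℝ) : ((n : ℝ) + 1) ^ c = (n : ℝ) ^ c * (1 + 1 / n) ^ c := by
    rw [← Real.mul_rpow hn0.le (by positivity)]
    congr 1
    field_simp
  have hr : (1 : ℝ) ≤ 1 + 1 / n := by
    have : (0 : ℝ) ≤ 1 / n := by positivity
    linarith
  have h1 : (n : ℝ) ^ a ≤ (n : ℝ) ^ b := Real.rpow_le_rpow_of_exponent_le (by linarith) hab.le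
  have h2 : (1 + 1 / (n : ℝ)) ^ a ≤ (1 + 1 / (n : ℝ)) ^ b :=
    Real.rpow_le_rpow_of_exponent_le hr hab.le
  have h3 : 1 ≤ (1 + 1 / (n : ℝ)) ^ a := Real.one_le_rpow hr ha.le
  have h4 : 0 < (n : ℝ) ^ a := Real.rpow_pos_of_pos hn0 _
  rw [e a, e b]
  nlinarith [mul_le_mul h1 (sub_le_sub_right h2 1) (by linarith) (by linarith)]

def Good (n : ℕ) (a b : ℝ) : Prop :=
  1.7355 ≤ a ∧ a < b ∧ ∃ p : ℕ, p.Prime ∧ FF n a = (p : ℝ) - 1 ∧ FF n b = p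

lemma exists_good (n : ℕ) (hn : 2 ≤ n) (p : ℕ) (hp : p.Prime) (hp3 : 3 ≤ p) {A B : ℝ}
    (hA' : 1.7355 ≤ A)
    (hA : FF n A ≤ (p : ℝ) - 1) (hB : (p : ℝ) ≤ FF n B) :
    ∃ a b, A ≤ a ∧ b ≤ B ∧ (FF n A < (p : ℝ) - 1 → A < a) ∧ ((p : ℝ) < FF n B → b < B) ∧
      Good n a b := by
  have hp' : (3 : ℝ) ≤ p := by exact_mod_cast hp3
  have ea := FF_inv n hn ((p : ℝ) - 1) (by linarith)
  have eb := FF_inv n hn (p : ℝ) (by linarith)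
  refine ⟨_, _, ?_, ?_, ?_, ?_, ?_, ?_, p, hp, ea, eb⟩
  · rw [← (FF_mono n hn).le_iff_le, ea]; exact hA
  · rw [← (FF_mono n hn).le_iff_le, eb]; exact hB
  · intro h; rw [← (FF_mono n hn).lt_iff_lt, ea]; exact h
  · intro h; rw [← (FF_mono n hn).lt_iff_lt, eb]; exact h
  · refine hA'.trans ?_
    rw [← (FF_mono n hn).le_iff_le, ea]; exact hA
  · rw [← (FF_mono n hn).lt_iff_lt, ea, eb]; linarith

lemma pr_spec (x : ℝ) : (pr x).Prime ∧ x < (pr x : ℝ) := by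
  have : (pr x) ∈ {p : ℕ | p.Prime ∧ x < (p : ℝ)} := by
    apply Nat.sInf_mem
    obtain ⟨p, hp, hpp⟩ := Nat.exists_infinite_primes (⌊x⌋₊ + 1)
    exact ⟨p, hpp, (Nat.lt_floor_add_one x).trans_le (by exact_mod_cast hp)⟩
  exact this

lemma step (hCramer : ∀ x : ℝ, 11 ≤ x → (pr x : ℝ) - x < (Real.log x) ^ 2)
    (n : ℕ) (hn : 20 ≤ n) (a b : ℝ) (h : Good n a b) :
    ∃ a' b', a < a' ∧ b' < b ∧ Good (n + 1) a' b' := by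
  obtain ⟨ha, hab, p, hp, hpa, hpb⟩ := h
  obtain ⟨hg, h11⟩ := growth n hn a ha
  have hc := hCramer _ h11
  obtain ⟨hq, hqx⟩ := pr_spec (FF (n + 1) a + 1)
  set q := pr (FF (n + 1) a + 1)
  have hr := ratio n (by omega) (by linarith) hab
  have hpos := FF_pos n a
  have hpos' := FF_pos (n + 1) a
  have h1 : FF (n + 1) a / FF n a ≤ FF (n + 1) b - FF (n + 1) a := by
    have e1 : FF n b / FF n a = 1 + 1 / FF n a := by
      rw [show FF n b = FF n a + 1 by linarith]; field_simp
    rw [e1, le_div_iff₀ hpos'] at hr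
    have e2 : FF (n + 1) a / FF n a = 1 / FF n a * FF (n + 1) a := by ring
    linarith
  have hq3 : 3 ≤ q := by
    have : (3 : ℝ) < q := by linarith
    exact_mod_cast this.le
  obtain ⟨a', b', -, -, h2, h3, h4⟩ := exists_good (n + 1) (by omega) q hq hq3 (A := a) (B := b) ha
    (by linarith) (by linarith)
  exact ⟨a', b', h2 (by linarith), h3 (by linarith), h4⟩

lemma limit (hCramer : ∀ x : ℝ, 11 ≤ x → (pr x : ℝ) - x < (Real.log x) ^ 2)
    (a b : ℝ) (h : Good 20 a b) :
    ∃ d, a < d ∧ d < b ∧ ∀ n, 20 ≤ n → ∃ p : ℕ, p.Prime ∧ (p : ℝ) - 1 ≤ FF n d ∧ FF n d < p := by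
  have hstep : ∀ m : ℕ, ∀ s : {s : ℝ × ℝ // Good (20 + m) s.1 s.2},
      ∃ t : {s : ℝ × ℝ // Good (20 + (m + 1)) s.1 s.2}, s.1.1 < t.1.1 ∧ t.1.2 < s.1.2 := by
    rintro m ⟨⟨a, b⟩, hs⟩
    obtain ⟨a', b', h1, h2, h3⟩ := step hCramer (20 + m) (by omega) a b hs
    exact ⟨⟨(a', b'), h3⟩, h1, h2⟩
  choose g hg1 hg2 using hstep
  let s : (m : ℕ) → {s : ℝ × ℝ // Good (20 + m) s.1 s.2} :=
    fun m => Nat.rec ⟨(a, b), h⟩ (fun m ih => g m ih) m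
  have hs1 : StrictMono (fun m => (s m).1.1) := strictMono_nat_of_lt_succ fun m => hg1 m (s m)
  have hs2 : StrictAnti (fun m => (s m).1.2) := strictAnti_nat_of_succ_lt fun m => hg2 m (s m)
  have hmem := Monotone.ciSup_mem_iInter_Icc_of_antitone hs1.monotone hs2.antitone
    (fun m => (s m).2.2.1.le)
  rw [Set.mem_iInter] at hmem
  set d := ⨆ m, (s m).1.1
  have hlo : ∀ m, (s m).1.1 < d := fun m => (hs1 (Nat.lt_succ_self m)).trans_le (hmem (m + 1)).1
  have hhi : ∀ m, d < (s m).1.2 := fun m => (hmem (m + 1)).2.trans_lt (hs2 (Nat.lt_succ_self m))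
  refine ⟨d, hlo 0, hhi 0, ?_⟩
  intro n hn
  obtain ⟨m, rfl⟩ := Nat.exists_eq_add_of_le hn
  obtain ⟨_, _, p, hp, hpa, hpb⟩ := (s m).2
  refine ⟨p, hp, ?_, ?_⟩
  · rw [← hpa]; exact (FF_lt _ (by omega) (hlo m)).le
  · rw [← hpb]; exact FF_lt _ (by omega) (hhi m)

lemma prime_of_bounds (x : ℝ) (p : ℕ) (hp : p.Prime) (h1 : (p : ℝ) - 1 ≤ x) (h2 : x < p) :
    Prime (1 + ⌊x⌋) := by
  have : ⌊x⌋ = (p : ℤ) - 1 := by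
    rw [Int.floor_eq_iff]; push_cast; constructor <;> linarith
  rw [this, add_sub_cancel]
  exact Nat.prime_iff_prime_int.1 hp

theorem stmt_5
    (hCramer : ∀ x : ℝ, 11 ≤ x → (pr x : ℝ) - x < (Real.log x) ^ 2) :
    ∃ d : ℝ, 1.7355149500 < d ∧ d < 1.7355149501 ∧
      (∀ n : ℕ, Prime (1 + ⌊(2 : ℝ) ^ ((n : ℝ) ^ d)⌋)) ∧
      StrictMono (fun n : ℕ => 1 + ⌊(2 : ℝ) ^ ((n : ℝ) ^ d)⌋) := by
  have hA1 : (1.7355149500 : ℝ) < (cA : ℝ) / cD := by norm_num [cA, cD]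
  have hB1 : (cB : ℝ) / cD < (1.7355149501 : ℝ) := by norm_num [cB, cD]
  have hpk : ∀ k, k < 21 → (pk k).Prime := by
    intro k hk
    apply pk_prime
    unfold pk
    rw [List.getD_eq_getElem _ _ (by simpa [pl] using hk)]
    exact List.getElem_mem _
  have h20 := chk_20
  rw [Bool.and_eq_true] at h20
  have h20a := FF_le _ _ _ _ _ _ _ _ _ _ _ h20.1
  have h20b := FF_ge _ _ _ _ _ _ _ _ _ _ _ h20.2
  have hp3 : 3 ≤ pk 20 := by decide +kernel
  rw [Nat.cast_sub (by omega), Nat.cast_one] at h20a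
  obtain ⟨a, b, haA, hbB, -, -, hG⟩ := exists_good 20 (by omega) (pk 20) (hpk 20 (by omega)) hp3
    (by linarith) h20a h20b
  obtain ⟨d, had, hdb, hd⟩ := limit hCramer a b hG
  refine ⟨d, by linarith, by linarith, ?_, ?_⟩
  · intro n
    have key : ∃ p : ℕ, p.Prime ∧ (p : ℝ) - 1 ≤ FF n d ∧ FF n d < p := by
      rcases Nat.lt_or_ge n 20 with hn | hn
      · rcases Nat.lt_or_ge n 2 with hn2 | hn2
        · interval_cases n
          · refine ⟨2, Nat.prime_two, ?_, ?_⟩ <;>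
            · unfold FF
              rw [Nat.cast_zero, Real.zero_rpow (by linarith), Real.rpow_zero]
              norm_num
          · refine ⟨3, Nat.prime_three, ?_, ?_⟩ <;>
            · unfold FF
              rw [Nat.cast_one, Real.one_rpow, Real.rpow_one]
              norm_num
        · have h := List.all_eq_true.1 chk_small n (by rw [List.mem_range'_1]; omega)
          rw [Bool.and_eq_true] at h
          have h1 := FF_ge _ _ _ _ _ _ _ _ _ _ _ h.1
          have h2 := FF_le _ _ _ _ _ _ _ _ _ _ _ h.2
          have hpr := hpk n (by omega)
          rw [Nat.cast_sub hpr.one_lt.le, Nat.cast_one] at h1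
          exact ⟨pk n, hpr, h1.trans (FF_lt n hn2 (by linarith)).le,
            (FF_lt n hn2 (by linarith)).trans_le h2⟩
      · exact hd n hn
    obtain ⟨p, hp, h1, h2⟩ := key
    exact prime_of_bounds _ p hp h1 h2
  · apply strictMono_nat_of_lt_succ
    intro n
    have hd1 : 1 ≤ d := by linarith
    have h1 : (n : ℝ) ^ d + 1 ≤ ((n + 1 : ℕ) : ℝ) ^ d := by
      have := Real.add_rpow_le_rpow_add (a := (n : ℝ)) (b := 1) (by positivity) (by norm_num) hd1
      rw [Real.one_rpow] at this
      push_cast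
      exact this
    have h2 : (2 : ℝ) ^ ((n : ℝ) ^ d) + 1 ≤ (2 : ℝ) ^ (((n + 1 : ℕ) : ℝ) ^ d) := by
      refine le_trans ?_ (Real.rpow_le_rpow_of_exponent_le one_le_two h1)
      rw [Real.rpow_add_one (by norm_num)]
      have : (1 : ℝ) ≤ 2 ^ ((n : ℝ) ^ d) :=
        Real.one_le_rpow one_le_two (Real.rpow_nonneg (by positivity) _)
      linarith
    have h3 := Int.floor_le_floor h2
    rw [Int.floor_add_one] at h3
    show 1 + _ < 1 + _
    omega
end

section
/- Assume there exists a constant H > 0 such that pr(x) − x < H·(ln x)² for every real x ≥ 2. Then for every real number d > 1 there exists a real number c ≥ 2 such that for every integer n ≥ 1 the number ⌊c^{n^d}⌋ is prime, and the map n ↦ ⌊c^{n^d}⌋ is strictly increasing on n ≥ 1 (so these primes are pairwise distinct). -/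
open Real

lemma asymp (K s : ℝ) : ∃ L : ℝ, 1 ≤ L ∧ ∀ u : ℝ, L ≤ u → K * u ^ s + 1 < Real.exp u := by
  have h1 : (fun u : ℝ => K * u ^ s) =o[Filter.atTop] Real.exp :=
    (isLittleO_rpow_exp_atTop s).const_mul_left K
  have h2 := h1.def (show (0:ℝ) < 1/2 by norm_num)
  obtain ⟨L, hL⟩ := Filter.eventually_atTop.1 h2
  refine ⟨max L 2, by simp, fun u hu => ?_⟩
  have h3 := hL u ((le_max_left _ _).trans hu)
  have hu2 : 2 ≤ u := (le_max_right _ _).trans hu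
  have h4 := Real.add_one_le_exp u
  rw [Real.norm_eq_abs, Real.norm_eq_abs, abs_of_pos (Real.exp_pos u)] at h3
  have h5 := le_abs_self (K * u ^ s)
  linarith

/-- `x ≥ 1` plays the role of `n`. -/
lemma step_s6 (H : ℝ) (hH : 0 < H)
    (hC : ∀ x : ℝ, 2 ≤ x → (pr x : ℝ) - x < H * (Real.log x) ^ 2) (d : ℝ) (hd : 1 < d) :
    ∃ L : ℝ, 1 ≤ L ∧ ∀ x : ℝ, 1 ≤ x → ∀ p : ℝ, 2 ≤ p → x ^ d * L ≤ Real.log p →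
      (pr (p ^ ((x+1) ^ d / x ^ d)) : ℝ) + 1 < (p + 1) ^ ((x+1) ^ d / x ^ d) := by
  obtain ⟨L, hL1, hL⟩ := asymp (H * 4 ^ d) (2 + 2 / (d-1))
  refine ⟨L, hL1, fun x hx p hp hlog => ?_⟩
  have hx0 : 0 < x := by linarith
  have hp0 : 0 < p := by linarith
  have hxd : 0 < x ^ d := Real.rpow_pos_of_pos hx0 d
  have hd1 : 0 < d - 1 := by linarith
  have hxe : 0 < x ^ (d-1) := Real.rpow_pos_of_pos hx0 _
  have hxe1 : 1 ≤ x ^ (d-1) := Real.one_le_rpow hx hd1.le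
  have hsplit : x ^ d = x ^ (d-1) * x := by
    rw [← Real.rpow_add_one hx0.ne']; congr 1; ring
  have hsplit' : (x+1) ^ d = (x+1) ^ (d-1) * (x+1) := by
    rw [← Real.rpow_add_one (by positivity)]; congr 1; ring
  have hmono : x ^ (d-1) ≤ (x+1) ^ (d-1) := Real.rpow_le_rpow hx0.le (by linarith) hd1.le
  have hdiff : x ^ (d-1) ≤ (x+1) ^ d - x ^ d := by
    rw [hsplit, hsplit']; nlinarith
  obtain ⟨t, ht⟩ : ∃ t, Real.log p = x ^ d * t := ⟨Real.log p / x ^ d, by field_simp⟩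
  have htL : L ≤ t := by
    rw [ht] at hlog; exact le_of_mul_le_mul_left hlog hxd
  have ht1 : 1 ≤ t := hL1.trans htL
  set r := (x+1) ^ d / x ^ d with hr
  have hr1 : 1 ≤ r := by
    rw [hr, one_le_div hxd]; linarith
  have hu := hL (x ^ (d-1) * t) (by nlinarith)
  set u := x ^ (d-1) * t with hudef
  have hu0 : 0 < u := by positivity
  -- lower bound for the length
  have hlen : p ^ r + Real.exp u ≤ (p+1) ^ r := by
    have e1 : (p+1) ^ r = (p+1) ^ (r-1) * (p+1) := by
      rw [← Real.rpow_add_one (by positivity)]; congr 1; ring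
    have e2 : p ^ r = p ^ (r-1) * p := by
      rw [← Real.rpow_add_one (by positivity)]; congr 1; ring
    have e3 : p ^ (r-1) ≤ (p+1) ^ (r-1) :=
      Real.rpow_le_rpow hp0.le (by linarith) (by linarith)
    have e4 : Real.exp u ≤ p ^ (r-1) := by
      rw [Real.rpow_def_of_pos hp0, ht]
      apply Real.exp_le_exp.2
      have : x ^ d * t * (r - 1) = ((x+1)^d - x^d) * t := by
        rw [hr]; field_simp
      rw [this, hudef]
      exact mul_le_mul_of_nonneg_right hdiff (by linarith)
    rw [e1, e2]
    nlinarith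
  have hpr : 2 ≤ p ^ r := hp.trans (Real.self_le_rpow_of_one_le (by linarith) hr1)
  have hc := hC _ hpr
  have hlogr : Real.log (p ^ r) = (x+1) ^ d * t := by
    rw [Real.log_rpow hp0, ht, hr]; field_simp
  have hbound : H * (Real.log (p ^ r)) ^ 2 ≤ H * 4 ^ d * u ^ (2 + 2 / (d-1)) := by
    rw [hlogr]
    have hxu : x ≤ u ^ (1/(d-1)) := by
      have : x = (x ^ (d-1)) ^ (1/(d-1)) := by
        rw [← Real.rpow_mul hx0.le, mul_one_div_cancel hd1.ne', Real.rpow_one]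
      refine this.le.trans ?_
      apply Real.rpow_le_rpow hxe.le _ (by positivity)
      rw [hudef]
      nlinarith
    have h2 : (x+1) ^ d ≤ 2 ^ d * x ^ d := by
      rw [← Real.mul_rpow (by norm_num) hx0.le]
      exact Real.rpow_le_rpow (by linarith) (by linarith) (by linarith)
    have h4 : (4:ℝ) ^ d = (2 ^ d) ^ 2 := by
      rw [show (4:ℝ) = 2 * 2 by norm_num, Real.mul_rpow (by norm_num) (by norm_num), sq]
    have h5 : u ^ (2 + 2 / (d-1)) = (u * u ^ (1/(d-1))) ^ 2 := by
      rw [mul_pow, Real.rpow_add hu0, ← Real.rpow_natCast (u ^ (1/(d-1))) 2,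
        ← Real.rpow_mul hu0.le, Real.rpow_two]
      congr 2; push_cast; ring
    rw [h4, h5, mul_assoc, ← mul_pow]
    have h6 : (x+1)^d * t ≤ 2 ^ d * (u * u ^ (1/(d-1))) := by
      calc (x+1)^d * t ≤ 2 ^ d * x ^ d * t := mul_le_mul_of_nonneg_right h2 (by linarith)
        _ = 2 ^ d * (u * x) := by rw [hsplit, hudef]; ring
        _ ≤ _ := by gcongr
    have h7 : 0 ≤ (x+1)^d * t := by positivity
    gcongr
  linarith

theorem stmt_6
    (hCramer : ∃ H : ℝ, 0 < H ∧ ∀ x : ℝ, 2 ≤ x → (pr x : ℝ) - x < H * (Real.log x) ^ 2) :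
    ∀ d : ℝ, 1 < d → ∃ c : ℝ, 2 ≤ c ∧
      (∀ n : ℕ, 1 ≤ n → Prime ⌊c ^ ((n : ℝ) ^ d)⌋) ∧
      StrictMonoOn (fun n : ℕ => ⌊c ^ ((n : ℝ) ^ d)⌋) {n : ℕ | 1 ≤ n} := by
  intro d hd
  obtain ⟨H, hH, hC⟩ := hCramer
  obtain ⟨L, hL1, hstep⟩ := step_s6 H hH hC d hd
  obtain ⟨p0, hp0, hp0p⟩ := Nat.exists_infinite_primes ⌈Real.exp L⌉₊
  have hp0L : Real.exp L ≤ p0 := (Nat.le_ceil _).trans (by exact_mod_cast hp0)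
  let a : ℕ → ℝ := fun n => ((n:ℝ) + 1) ^ d
  have ha : ∀ n, 0 < a n := fun n => by positivity
  have hamono : ∀ n, a n ≤ a (n+1) := fun n =>
    Real.rpow_le_rpow (by positivity) (by push_cast; linarith) (by linarith)
  let P : ℕ → ℕ := fun n => Nat.rec (motive := fun _ => ℕ) p0 (fun n p => pr (((p:ℕ):ℝ) ^ (a (n+1) / a n))) n
  have hPs : ∀ n, P (n+1) = pr ((P n : ℝ) ^ (a (n+1) / a n)) := by
    intro n; rfl
  have hprime : ∀ n, (P n).Prime := by
    intro n
    cases n with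
    | zero => exact hp0p
    | succ n => rw [hPs]; exact (pr_spec _).1
  have hP2 : ∀ n, (2:ℝ) ≤ P n := fun n => by exact_mod_cast (hprime n).two_le
  have hPpos : ∀ n, (0:ℝ) < P n := fun n => by linarith [hP2 n]
  have hlow : ∀ n, (P n : ℝ) ^ (a (n+1) / a n) < P (n+1) := by
    intro n; rw [hPs]; exact (pr_spec _).2
  have hinv : ∀ n, a n * L ≤ Real.log (P n) := by
    intro n
    induction n with
    | zero =>
      have : a 0 = 1 := by simp [a]
      rw [this, one_mul]
      exact (Real.le_log_iff_exp_le (by exact_mod_cast hp0p.pos)).2 hp0L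
    | succ n ih =>
      have h := Real.log_le_log (Real.rpow_pos_of_pos (hPpos n) _) (hlow n).le
      rw [Real.log_rpow (hPpos n)] at h
      refine le_trans ?_ h
      have h2 := mul_le_mul_of_nonneg_left ih (div_pos (ha (n+1)) (ha n)).le
      refine le_trans (le_of_eq ?_) h2
      have := (ha n).ne'
      field_simp
  have hup : ∀ n, (P (n+1) : ℝ) + 1 < ((P n : ℝ) + 1) ^ (a (n+1) / a n) := by
    intro n
    have h := hstep ((n:ℝ)+1) (by linarith [Nat.cast_nonneg (α := ℝ) n]) (P n) (hP2 n) (hinv n)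
    have e : ((n:ℝ)+1+1) ^ d = a (n+1) := by simp [a]
    rw [e] at h
    rw [hPs]; exact h
  have hPlt : ∀ n, P n < P (n+1) := by
    intro n
    have h : (P n : ℝ) < P (n+1) := lt_of_le_of_lt
      (Real.self_le_rpow_of_one_le (by linarith [hP2 n]) ((one_le_div (ha n)).2 (hamono n))) (hlow n)
    exact_mod_cast h
  let l : ℕ → ℝ := fun n => (P n : ℝ) ^ (1 / a n)
  let u : ℕ → ℝ := fun n => ((P n : ℝ) + 1) ^ (1 / a n)
  have hexp : ∀ n, ∀ y : ℝ, 0 ≤ y → (y ^ (a (n+1) / a n)) ^ (1 / a (n+1)) = y ^ (1 / a n) := by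
    intro n y hy
    rw [← Real.rpow_mul hy]
    congr 1
    have := (ha n).ne'
    have := (ha (n+1)).ne'
    field_simp
  have hl : Monotone l := monotone_nat_of_le_succ fun n => by
    show (P n : ℝ) ^ (1 / a n) ≤ (P (n+1) : ℝ) ^ (1 / a (n+1))
    rw [← hexp n _ (hPpos n).le]
    exact Real.rpow_le_rpow (Real.rpow_nonneg (hPpos n).le _) (hlow n).le
      (one_div_pos.2 (ha _)).le
  have hu : StrictAnti u := strictAnti_nat_of_succ_lt fun n => by
    show ((P (n+1) : ℝ) + 1) ^ (1 / a (n+1)) < ((P n : ℝ) + 1) ^ (1 / a n)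
    rw [← hexp n _ (by linarith [hPpos n])]
    exact Real.rpow_lt_rpow (by linarith [hPpos (n+1)]) (hup n) (one_div_pos.2 (ha _))
  have hlu : ∀ n, l n ≤ u n := fun n =>
    Real.rpow_le_rpow (hPpos n).le (by linarith) (one_div_pos.2 (ha _)).le
  have hlu' : ∀ m n, l m ≤ u n := fun m n =>
    (hl (le_max_left m n)).trans ((hlu _).trans (hu.antitone (le_max_right m n)))
  have hbdd : BddAbove (Set.range l) := ⟨u 0, by rintro _ ⟨m, rfl⟩; exact hlu' m 0⟩
  let c := ⨆ n, l n
  have hlc : ∀ n, l n ≤ c := fun n => le_ciSup hbdd n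
  have hcu : ∀ n, c < u n := fun n =>
    lt_of_le_of_lt (ciSup_le fun m => hlu' m (n+1)) (hu (Nat.lt_succ_self n))
  have hl0 : l 0 = P 0 := by simp [l, a]
  have hc2 : 2 ≤ c := by
    have := hlc 0
    rw [hl0] at this
    exact (hP2 0).trans this
  have hfloor : ∀ n : ℕ, ⌊c ^ (((n+1 : ℕ) : ℝ) ^ d)⌋ = (P n : ℤ) := by
    intro n
    have e : (((n+1 : ℕ) : ℝ) ^ d) = a n := by simp [a]
    rw [e, Int.floor_eq_iff]
    have e1 : ∀ y : ℝ, 0 ≤ y → (y ^ (1 / a n)) ^ a n = y := fun y hy => by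
      rw [← Real.rpow_mul hy, one_div_mul_cancel (ha n).ne', Real.rpow_one]
    constructor
    · have := Real.rpow_le_rpow (Real.rpow_nonneg (hPpos n).le _) (hlc n) (ha n).le
      rw [e1 _ (hPpos n).le] at this
      exact_mod_cast this
    · have := Real.rpow_lt_rpow (by linarith) (hcu n) (ha n)
      rw [e1 _ (by linarith [hPpos n])] at this
      exact_mod_cast this
  refine ⟨c, hc2, ?_, ?_⟩
  · intro n hn
    obtain ⟨m, rfl⟩ := Nat.exists_eq_add_of_le' hn
    rw [hfloor]
    exact Nat.prime_iff_prime_int.1 (hprime m)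
  · intro i hi j hj hij
    obtain ⟨i, rfl⟩ := Nat.exists_eq_add_of_le' hi
    obtain ⟨j, rfl⟩ := Nat.exists_eq_add_of_le' hj
    show ⌊c ^ (((i+1 : ℕ) : ℝ) ^ d)⌋ < ⌊c ^ (((j+1 : ℕ) : ℝ) ^ d)⌋
    rw [hfloor, hfloor]
    exact_mod_cast strictMono_nat_of_lt_succ hPlt (by omega : i < j)
end

section
/- Assume there exists a constant H > 0 such that pr(x) − x < H·(ln x)² for every real x ≥ 2. Then for every real number d > 1 there exists a real number c ≥ 2 such that for every integer n ≥ 0 the number 1 + ⌊c^{n^d}⌋ is prime, and the map n ↦ 1 + ⌊c^{n^d}⌋ is strictly increasing on n ≥ 0 (so these primes are pairwise distinct). -/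
open Real

lemma lemA (K d : ℝ) (hK : 0 < K) (hd : 1 < d) :
    ∃ M : ℝ, 1 ≤ M ∧ ∀ n : ℕ, 1 ≤ n → ∀ L : ℝ, (n : ℝ) ^ d * M ≤ L →
      K * L ^ 2 ≤ Real.exp (L / n) := by
  have hd1 : 0 < d - 1 := by linarith
  have h := (isLittleO_rpow_exp_atTop (2 + 2 / (d - 1))).bound (inv_pos.mpr hK)
  obtain ⟨T, hT⟩ := Filter.eventually_atTop.1 h
  refine ⟨max T 1, le_max_right _ _, fun n hn L hL => ?_⟩
  have hn1 : (1 : ℝ) ≤ n := by exact_mod_cast hn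
  have hn0 : (0 : ℝ) < n := by linarith
  set t := L / n with ht
  have hLt : L = n * t := by rw [ht]; field_simp
  have hnd : (n : ℝ) ^ d = n * (n : ℝ) ^ (d - 1) := by
    rw [← Real.rpow_one_add' hn0.le (by linarith)]; congr 1; ring
  have h1 : (n : ℝ) ^ (d - 1) * max T 1 ≤ t := by
    rw [hnd, hLt, mul_assoc] at hL
    exact le_of_mul_le_mul_left hL hn0
  have hM : 1 ≤ max T 1 := le_max_right _ _
  have hp1 : 1 ≤ (n : ℝ) ^ (d - 1) := Real.one_le_rpow hn1 hd1.le
  have hMt : max T 1 ≤ t := by nlinarith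
  have ht1 : 1 ≤ t := hM.trans hMt
  have ht0 : 0 < t := by linarith
  have hnt : (n : ℝ) ^ (d - 1) ≤ t := by nlinarith
  have hn2 : (n : ℝ) ≤ t ^ (1 / (d - 1)) := by
    have := Real.rpow_le_rpow (by positivity) hnt (show 0 ≤ 1 / (d - 1) by positivity)
    rwa [← Real.rpow_mul hn0.le, mul_one_div_cancel hd1.ne', Real.rpow_one] at this
  have hb := hT t ((le_max_left _ _).trans hMt)
  rw [Real.norm_of_nonneg (by positivity), Real.norm_of_nonneg (by positivity)] at hb
  have hsplit : t ^ (2 + 2 / (d - 1)) = t ^ 2 * (t ^ (1 / (d - 1))) ^ 2 := by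
    rw [Real.rpow_add ht0, Real.rpow_two, ← Real.rpow_two (t ^ (1 / (d - 1))), ← Real.rpow_mul ht0.le]
    congr 2; ring
  rw [hsplit] at hb
  have hsq : (n : ℝ) ^ 2 ≤ (t ^ (1 / (d - 1))) ^ 2 := pow_le_pow_left₀ hn0.le hn2 2
  calc K * L ^ 2 = K * (t ^ 2 * (n : ℝ) ^ 2) := by rw [hLt]; ring
    _ ≤ K * (t ^ 2 * (t ^ (1 / (d - 1))) ^ 2) := by gcongr
    _ ≤ K * (K⁻¹ * Real.exp t) := by gcongr
    _ = Real.exp t := by field_simp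

lemma lemB (H : ℝ) (hH : 0 < H)
    (hC : ∀ x : ℝ, 2 ≤ x → (pr x : ℝ) - x < H * (Real.log x) ^ 2) (d : ℝ) (hd : 1 < d) :
    ∃ C : ℝ, 2 ≤ C ∧ ∀ n : ℕ, ∀ p : ℕ, 
      C ^ (((n + 1 : ℕ) : ℝ) ^ d) ≤ (p : ℝ) - 1 → ∃ p' : ℕ, p'.Prime ∧
      C ^ (((n + 2 : ℕ) : ℝ) ^ d) ≤ (p' : ℝ) - 1 ∧
      ((p : ℝ) - 1) ^ ((((n + 2 : ℕ) : ℝ) ^ d) / (((n + 1 : ℕ) : ℝ) ^ d)) ≤ (p' : ℝ) - 1 ∧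
      (p' : ℝ) < (p : ℝ) ^ ((((n + 2 : ℕ) : ℝ) ^ d) / (((n + 1 : ℕ) : ℝ) ^ d)) := by
  set R : ℝ := 2 ^ d with hR
  have hR0 : 0 < R := by positivity
  obtain ⟨M, hM, hA⟩ := lemA (1 + 4 * H * R ^ 2) d (by positivity) hd
  refine ⟨Real.exp M, by linarith [Real.add_one_le_exp M], fun n p hp => ?_⟩
  have hA := hA (n + 1) (by omega)
  set m : ℝ := ((n + 1 : ℕ) : ℝ) with hm
  have hm1 : 1 ≤ m := by rw [hm]; exact_mod_cast (by omega : 1 ≤ n + 1)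
  have hm2 : ((n + 2 : ℕ) : ℝ) = m + 1 := by rw [hm]; push_cast; ring
  rw [hm2]
  have hm0 : 0 < m := by linarith
  set q : ℝ := (p : ℝ) - 1 with hq
  have hpq : (p : ℝ) = q + 1 := by rw [hq]; ring
  rw [hpq]
  set r : ℝ := (m + 1) ^ d / m ^ d with hr
  have hmd : 1 ≤ m ^ d := Real.one_le_rpow hm1 (by linarith)
  have hr' : r = (1 + 1 / m) ^ d := by
    rw [hr, ← Real.div_rpow (by positivity) hm0.le]; congr 1; field_simp
  have hrR : r ≤ R := by
    rw [hr', hR]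
    apply Real.rpow_le_rpow (by positivity) _ (by linarith)
    have : 1 / m ≤ 1 := by rw [div_le_one hm0]; exact hm1
    linarith
  have hr1 : 1 / m ≤ r - 1 := by
    have h := one_add_mul_self_le_rpow_one_add (s := 1 / m) (by have : 0 < 1 / m := by positivity
                                                                linarith) hd.le
    rw [← hr'] at h
    have : 0 < 1 / m := by positivity
    nlinarith
  have hr0 : 1 < r := by
    have : 0 < 1 / m := by positivity
    linarith
  have hq0 : 0 < q := lt_of_lt_of_le (by positivity) hp
  have hL : m ^ d * M ≤ Real.log q := by
    have := Real.log_le_log (by positivity) hp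
    rwa [Real.log_rpow (by positivity), Real.log_exp] at this
  set L := Real.log q with hLdef
  have hL1 : 1 ≤ L := by nlinarith
  have hA := hA L hL
  have hqe : 2 ≤ q := by
    have := Real.exp_log hq0
    linarith [Real.add_one_le_exp (Real.log q)]
  have hqr : q ≤ q ^ r := by
    simpa using Real.rpow_le_rpow_of_exponent_le (by linarith : 1 ≤ q) hr0.le
  have hlog0 : 0 ≤ Real.log (q ^ r + 1) := Real.log_nonneg (by linarith)
  have hlog : Real.log (q ^ r + 1) ≤ 2 * R * L := by
    have h1 : Real.log (q ^ r + 1) ≤ Real.log (q ^ r * q ^ r) :=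
      Real.log_le_log (by linarith) (by nlinarith)
    rw [Real.log_mul (by positivity) (by positivity), Real.log_rpow hq0] at h1
    nlinarith
  have hlog2 : (Real.log (q ^ r + 1)) ^ 2 ≤ 4 * R ^ 2 * L ^ 2 := by
    have := pow_le_pow_left₀ hlog0 hlog 2
    nlinarith
  have hexp : Real.exp (L / m) ≤ q ^ (r - 1) := by
    rw [Real.rpow_def_of_pos hq0]
    apply Real.exp_le_exp.2
    rw [div_eq_mul_one_div]
    gcongr
  have hbig : q ^ r + q ^ (r - 1) ≤ (q + 1) ^ r := by
    have e1 : ∀ y : ℝ, 0 < y → y ^ r = y * y ^ (r - 1) := fun y hy => by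
      rw [← Real.rpow_one_add' hy.le (by linarith)]; congr 1; ring
    rw [e1 (q + 1) (by linarith), e1 q hq0]
    have : q ^ (r - 1) ≤ (q + 1) ^ (r - 1) :=
      Real.rpow_le_rpow hq0.le (by linarith) (by linarith)
    nlinarith
  have hx := hC (q ^ r + 1) (by linarith)
  obtain ⟨hs1, hs2⟩ := pr_spec (q ^ r + 1)
  refine ⟨pr (q ^ r + 1), hs1, ?_, by linarith, ?_⟩
  · have h1 := Real.rpow_le_rpow (by positivity) hp (by linarith : 0 ≤ r)
    rw [← Real.rpow_mul (by positivity), hr, mul_div_cancel₀ _ (by positivity), ← hr] at h1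
    linarith
  · have : H * (Real.log (q ^ r + 1)) ^ 2 ≤ H * (4 * R ^ 2 * L ^ 2) := by gcongr
    nlinarith

theorem stmt_7
    (hCramer : ∃ H : ℝ, 0 < H ∧ ∀ x : ℝ, 2 ≤ x → (pr x : ℝ) - x < H * (Real.log x) ^ 2) :
    ∀ d : ℝ, 1 < d → ∃ c : ℝ, 2 ≤ c ∧
      (∀ n : ℕ, Prime (1 + ⌊c ^ ((n : ℝ) ^ d)⌋)) ∧
      StrictMono (fun n : ℕ => 1 + ⌊c ^ ((n : ℝ) ^ d)⌋) := by
  intro d hd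
  obtain ⟨H, hH, hC⟩ := hCramer
  obtain ⟨C, hC2, hstep⟩ := lemB H hH hC d hd
  choose! f hf1 hf2 hf3 hf4 using hstep
  obtain ⟨hp01, hp02⟩ := pr_spec (C + 1)
  obtain ⟨P, hP0, hPs⟩ : ∃ P : ℕ → ℕ, P 0 = pr (C + 1) ∧ ∀ k, P (k + 1) = f k (P k) :=
    ⟨fun k => Nat.rec (pr (C + 1)) (fun n p => f n p) k, rfl, fun k => rfl⟩
  have hinv : ∀ k : ℕ, (P k).Prime ∧ C ^ (((k + 1 : ℕ) : ℝ) ^ d) ≤ ((P k : ℕ) : ℝ) - 1 := by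
    intro k
    induction k with
    | zero =>
      rw [hP0]
      refine ⟨hp01, ?_⟩
      simp; linarith
    | succ k ih =>
      rw [hPs]
      exact ⟨hf1 k _ ih.2, hf2 k _ ih.2⟩
  let e : ℕ → ℝ := fun k => ((k + 1 : ℕ) : ℝ) ^ d
  have he : ∀ k, 0 < e k := fun k => by
    have : (0 : ℝ) < ((k + 1 : ℕ) : ℝ) := by positivity
    exact Real.rpow_pos_of_pos this _
  have hQ0 : ∀ k, 0 < (P k : ℝ) - 1 := fun k =>
    lt_of_lt_of_le (Real.rpow_pos_of_pos (by linarith) _) (hinv k).2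
  let a : ℕ → ℝ := fun k => ((P k : ℝ) - 1) ^ (e k)⁻¹
  let b : ℕ → ℝ := fun k => (P k : ℝ) ^ (e k)⁻¹
  have key : ∀ k (y : ℝ), 0 ≤ y → (y ^ (e (k + 1) / e k)) ^ (e (k + 1))⁻¹ = y ^ (e k)⁻¹ := by
    intro k y hy
    rw [← Real.rpow_mul hy]
    congr 1
    have := he k; have := he (k + 1)
    field_simp
  have ha : Monotone a := monotone_nat_of_le_succ fun k => by
    have h := hf3 k _ (hinv k).2
    rw [← hPs] at h
    have h := Real.rpow_le_rpow (Real.rpow_nonneg (hQ0 k).le _) h (inv_pos.2 (he (k + 1))).le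
    have h2 := key k _ (hQ0 k).le
    exact h2.symm.trans_le h
  have hb : StrictAnti b := strictAnti_nat_of_succ_lt fun k => by
    have h := hf4 k _ (hinv k).2
    rw [← hPs] at h
    have h := Real.rpow_lt_rpow (Nat.cast_nonneg _) h (inv_pos.2 (he (k + 1)))
    have h2 := key k (P k) (Nat.cast_nonneg _)
    exact h.trans_eq h2
  have hab : ∀ k, a k ≤ b k := fun k =>
    Real.rpow_le_rpow (hQ0 k).le (by linarith) (inv_pos.2 (he k)).le
  have hab2 : ∀ j k, a j ≤ b k := fun j k =>
    (ha (le_max_left j k)).trans ((hab _).trans (hb.antitone (le_max_right j k)))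
  have hbdd : BddAbove (Set.range a) := ⟨b 0, by rintro _ ⟨j, rfl⟩; exact hab2 j 0⟩
  have hac : ∀ k, a k ≤ iSup a := fun k => le_ciSup hbdd k
  have hcb : ∀ k, iSup a < b k := fun k =>
    lt_of_le_of_lt (ciSup_le fun j => hab2 j (k + 1)) (hb (Nat.lt_succ_self k))
  generalize iSup a = c at hac hcb
  have hc2 : 2 ≤ c := by
    have h := hac 0
    have h0 : a 0 = (pr (C + 1) : ℝ) - 1 := by
      simp only [a, e, hP0]
      simp
    linarith
  refine ⟨c, hc2, ?_, ?_⟩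
  · intro n
    rcases n with _ | k
    · have : (1 + ⌊c ^ (((0 : ℕ) : ℝ) ^ d)⌋ : ℤ) = ((2 : ℕ) : ℤ) := by
        rw [Nat.cast_zero, Real.zero_rpow (by linarith), Real.rpow_zero, Int.floor_one]; norm_num
      rw [this]
      exact Nat.prime_iff_prime_int.1 Nat.prime_two
    · have hfl : ⌊c ^ (((k + 1 : ℕ) : ℝ) ^ d)⌋ = (P k : ℤ) - 1 := by
        rw [Int.floor_eq_iff]
        have h1 := Real.rpow_le_rpow (Real.rpow_nonneg (hQ0 k).le _) (hac k) (he k).le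
        have h2 := Real.rpow_lt_rpow (by linarith) (hcb k) (he k)
        simp only [a, b] at h1 h2
        rw [Real.rpow_inv_rpow (hQ0 k).le (he k).ne'] at h1
        rw [Real.rpow_inv_rpow (Nat.cast_nonneg _) (he k).ne'] at h2
        push_cast
        simp only [e] at h1 h2
        push_cast at h1 h2
        constructor <;> linarith
      rw [hfl, add_sub_cancel]
      exact Nat.prime_iff_prime_int.1 (hinv k).1
  · apply strictMono_nat_of_lt_succ
    intro n
    have h1 : (n : ℝ) ^ d + 1 ≤ ((n + 1 : ℕ) : ℝ) ^ d := by
      have := Real.add_rpow_le_rpow_add (Nat.cast_nonneg n) (zero_le_one' ℝ) hd.le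
      rw [Real.one_rpow] at this
      push_cast; exact this
    have h2 := Real.rpow_le_rpow_of_exponent_le (by linarith : 1 ≤ c) h1
    rw [Real.rpow_add (by linarith), Real.rpow_one] at h2
    have h3 : 1 ≤ c ^ ((n : ℝ) ^ d) := Real.one_le_rpow (by linarith) (by positivity)
    have h4 : c ^ ((n : ℝ) ^ d) + 1 ≤ c ^ (((n + 1 : ℕ) : ℝ) ^ d) := by nlinarith
    have h5 := Int.floor_le_floor h4
    rw [Int.floor_add_one] at h5
    omega
end

section
/- Assume there exists a constant H > 0 such that pr(x) − x < H·(ln x)² for every real x ≥ 2. Then there exists a real number d > 1 such that for every integer n ≥ 1 the number ⌊2^{n^d}⌋ is prime, and the map n ↦ ⌊2^{n^d}⌋ is strictly increasing on n ≥ 1 (so these primes are pairwise distinct). -/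
open Real

lemma bern_aux (n : ℕ) (hn : 1 ≤ n) (d : ℝ) (hd : 1 ≤ d) :
    (n : ℝ) ^ d + d * (n : ℝ) ^ (d - 1) ≤ ((n : ℝ) + 1) ^ d := by
  have hn0 : (0 : ℝ) < n := by exact_mod_cast hn
  have h1 : 1 + d * (1 / (n : ℝ)) ≤ (1 + 1 / (n : ℝ)) ^ d :=
    one_add_mul_self_le_rpow_one_add (by have : (0 : ℝ) ≤ 1 / n := by positivity
                                         linarith) hd
  have h2 : ((n : ℝ) + 1) ^ d = (n : ℝ) ^ d * (1 + 1 / (n : ℝ)) ^ d := by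
    rw [← Real.mul_rpow hn0.le (by positivity)]
    congr 1
    field_simp
  have h3 : (n : ℝ) ^ d * (d * (1 / (n : ℝ))) = d * (n : ℝ) ^ (d - 1) := by
    rw [Real.rpow_sub_one hn0.ne']
    field_simp
  rw [h2]
  have := mul_le_mul_of_nonneg_left h1 (Real.rpow_nonneg hn0.le d)
  rw [mul_add, h3] at this
  linarith

lemma growth_aux (H : ℝ) (hH : 0 < H) : ∃ D : ℝ, 5 ≤ D ∧ ∀ n : ℕ, 2 ≤ n → ∀ d : ℝ, D ≤ d →
    H * (Real.log ((2 : ℝ) ^ (((n : ℝ) + 1) ^ d))) ^ 2 + 1 ≤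
      (2 : ℝ) ^ (((n : ℝ) + 1) ^ d - (n : ℝ) ^ d) := by
  obtain ⟨C, hC⟩ := pow_unbounded_of_one_lt (H + 1) (by norm_num : (1 : ℝ) < 2)
  refine ⟨max 5 C, le_max_left _ _, ?_⟩
  intro n hn d hd
  have hd5 : 5 ≤ d := le_trans (le_max_left _ _) hd
  have hdC : (C : ℝ) ≤ d := le_trans (le_max_right _ _) hd
  have hn2 : (2 : ℝ) ≤ n := by exact_mod_cast hn
  have hb := bern_aux n (by omega) d (by linarith)
  have h8 : 8 * (n : ℝ) ≤ (n : ℝ) ^ (d - 1) := by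
    calc 8 * (n : ℝ) ≤ (n : ℝ) ^ (4 : ℕ) := by
          have : (8 : ℝ) ≤ (n : ℝ) ^ 3 := by
            calc (8 : ℝ) = 2 ^ 3 := by norm_num
              _ ≤ _ := by gcongr
          nlinarith
      _ = (n : ℝ) ^ (4 : ℝ) := by rw [← Real.rpow_natCast]; norm_num
      _ ≤ _ := Real.rpow_le_rpow_of_exponent_le (by linarith) (by linarith)
  have hexp : (C : ℝ) + n * (2 * d) ≤ ((n : ℝ) + 1) ^ d - (n : ℝ) ^ d := by
    have : d * (8 * n) ≤ d * (n : ℝ) ^ (d - 1) := by gcongr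
    nlinarith
  have hlog0 : 0 < Real.log 2 := Real.log_pos (by norm_num)
  have hlog1 : Real.log 2 ≤ 1 := by linarith [Real.log_two_lt_d9]
  set t := ((n : ℝ) + 1) ^ d with ht
  have ht1 : 1 ≤ t := Real.one_le_rpow (by linarith) (by linarith)
  have ht2 : t ^ 2 ≤ (2 : ℝ) ^ (n * (2 * d)) := by
    have hle : (n : ℝ) + 1 ≤ 2 ^ n := by
      have : n + 1 ≤ 2 ^ n := Nat.lt_two_pow_self
      exact_mod_cast this
    have : t ≤ (2 : ℝ) ^ (n * d) := by
      rw [Real.rpow_mul (by norm_num), Real.rpow_natCast]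
      exact Real.rpow_le_rpow (by linarith) hle (by linarith)
    calc t ^ 2 ≤ ((2 : ℝ) ^ (n * d)) ^ 2 := by gcongr
      _ = _ := by
        rw [← Real.rpow_mul_natCast (by norm_num)]
        congr 1
        push_cast
        ring
  rw [Real.log_rpow (by norm_num)]
  have hl : (t * Real.log 2) ^ 2 ≤ t ^ 2 := by
    have : t * Real.log 2 ≤ t := by nlinarith
    have h0 : 0 ≤ t * Real.log 2 := by positivity
    gcongr
  calc H * (t * Real.log 2) ^ 2 + 1 ≤ H * t ^ 2 + t ^ 2 := by
        have : 1 ≤ t ^ 2 := one_le_pow₀ ht1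
        gcongr
    _ = (H + 1) * t ^ 2 := by ring
    _ ≤ (2 : ℝ) ^ C * (2 : ℝ) ^ (n * (2 * d)) := by gcongr
    _ = (2 : ℝ) ^ ((C : ℝ) + n * (2 * d)) := by
        rw [Real.rpow_add (by norm_num), Real.rpow_natCast]
    _ ≤ _ := Real.rpow_le_rpow_of_exponent_le (by norm_num) hexp

lemma inv_aux (b : ℝ) (hb : 1 < b) (z : ℝ) (hz : 1 < z) : ∃ t : ℝ, (2 : ℝ) ^ (b ^ t) = z := by
  have h1 : 0 < Real.logb 2 z := Real.logb_pos (by norm_num) hz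
  refine ⟨Real.logb b (Real.logb 2 z), ?_⟩
  rw [Real.rpow_logb (by linarith) hb.ne' h1, Real.rpow_logb (by norm_num) (by norm_num)
    (by linarith)]

lemma lt_aux (b : ℝ) (hb : 1 < b) (s t : ℝ) : (2 : ℝ) ^ (b ^ s) < (2 : ℝ) ^ (b ^ t) ↔ s < t := by
  rw [Real.rpow_lt_rpow_left_iff (by norm_num), Real.rpow_lt_rpow_left_iff hb]

lemma le_aux (b : ℝ) (hb : 1 < b) (s t : ℝ) : (2 : ℝ) ^ (b ^ s) ≤ (2 : ℝ) ^ (b ^ t) ↔ s ≤ t := by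
  rw [Real.rpow_le_rpow_left_iff (by norm_num), Real.rpow_le_rpow_left_iff hb]

lemma diff_mono (n : ℕ) (hn : 1 ≤ n) (d e : ℝ) (hd : 0 ≤ d) (hde : d ≤ e) :
    ((n : ℝ) + 1) ^ d - (n : ℝ) ^ d ≤ ((n : ℝ) + 1) ^ e - (n : ℝ) ^ e := by
  have hn1 : (1 : ℝ) ≤ n := by exact_mod_cast hn
  have key : ∀ t : ℝ, ((n : ℝ) + 1) ^ t - (n : ℝ) ^ t =
      (n : ℝ) ^ t * ((1 + 1 / (n : ℝ)) ^ t - 1) := by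
    intro t
    rw [mul_sub, ← Real.mul_rpow (by linarith) (by positivity)]
    have : (n : ℝ) * (1 + 1 / (n : ℝ)) = n + 1 := by field_simp
    rw [this, mul_one]
  have hr : (1 : ℝ) ≤ 1 + 1 / (n : ℝ) := by
    have : (0 : ℝ) ≤ 1 / n := by positivity
    linarith
  rw [key, key]
  have h1 := Real.rpow_le_rpow_of_exponent_le hn1 hde
  have h2 := Real.rpow_le_rpow_of_exponent_le hr hde
  have h3 := Real.one_le_rpow hr hd
  exact mul_le_mul h1 (by linarith) (by linarith) (by positivity)

def PP (D : ℝ) (n : ℕ) (q : ℝ × ℝ) : Prop :=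
  D ≤ q.1 ∧ q.1 < q.2 ∧ ∃ p : ℕ, p.Prime ∧ (2 : ℝ) ^ ((n : ℝ) ^ q.1) = p ∧
    (2 : ℝ) ^ ((n : ℝ) ^ q.2) = p + 1

theorem stmt_8
    (hCramer : ∃ H : ℝ, 0 < H ∧ ∀ x : ℝ, 2 ≤ x → (pr x : ℝ) - x < H * (Real.log x) ^ 2) :
    ∃ d : ℝ, 1 < d ∧
      (∀ n : ℕ, 1 ≤ n → Prime ⌊(2 : ℝ) ^ ((n : ℝ) ^ d)⌋) ∧
      StrictMonoOn (fun n : ℕ => ⌊(2 : ℝ) ^ ((n : ℝ) ^ d)⌋) {n : ℕ | 1 ≤ n} := by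
  obtain ⟨H, hH, hC⟩ := hCramer
  obtain ⟨D, hD5, hD⟩ := growth_aux H hH
  have step : ∀ (n : ℕ) (q : ℝ × ℝ), ∃ q' : ℝ × ℝ, 2 ≤ n → PP D n q →
      PP D (n + 1) q' ∧ q.1 ≤ q'.1 ∧ q'.2 < q.2 := by
    intro n q
    by_cases h : 2 ≤ n ∧ PP D n q
    swap
    · exact ⟨q, fun h1 h2 => absurd ⟨h1, h2⟩ h⟩
    obtain ⟨hn, hDq, hq, p, hp, hp1, hp2⟩ := h
    have hn2 : (2 : ℝ) ≤ n := by exact_mod_cast hn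
    have hb : (1 : ℝ) < (n : ℝ) + 1 := by linarith
    have hp0 : (0 : ℝ) < p := by exact_mod_cast hp.pos
    set x := (2 : ℝ) ^ (((n : ℝ) + 1) ^ q.1) with hx
    set y := (2 : ℝ) ^ (((n : ℝ) + 1) ^ q.2) with hy
    have hx2 : 2 ≤ x := by
      have : (2 : ℝ) ^ (1 : ℝ) ≤ x := Real.rpow_le_rpow_of_exponent_le (by norm_num)
        (Real.one_le_rpow hb.le (by linarith))
      simpa using this
    have hg := hD n hn q.1 hDq
    rw [Real.rpow_sub (by norm_num), hp1, ← hx] at hg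
    have hyx : x + x / p ≤ y := by
      have hm := diff_mono n (by omega) q.1 q.2 (by linarith) hq.le
      have hm' := Real.rpow_le_rpow_of_exponent_le (by norm_num : (1 : ℝ) ≤ 2) hm
      rw [Real.rpow_sub (by norm_num), Real.rpow_sub (by norm_num), hp1, hp2, ← hx, ← hy,
        le_div_iff₀ (by linarith)] at hm'
      calc x + x / p = x / p * (p + 1) := by field_simp
        _ ≤ y := hm'
    obtain ⟨hpp, hxp⟩ := pr_spec x
    have hcx := hC x hx2
    obtain ⟨d', hd'⟩ := inv_aux _ hb (pr x) (by linarith)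
    obtain ⟨e', he'⟩ := inv_aux _ hb ((pr x : ℝ) + 1) (by linarith)
    have hdd : q.1 < d' := by rw [← lt_aux _ hb, hd']; exact hxp
    have hde : d' < e' := by rw [← lt_aux _ hb, hd', he']; linarith
    have hee : e' < q.2 := by rw [← lt_aux _ hb, he', ← hy]; linarith
    refine ⟨(d', e'), fun _ _ => ⟨⟨by simp only; linarith, hde, pr x, hpp, ?_, ?_⟩, hdd.le, hee⟩⟩
    · push_cast; exact hd'
    · push_cast; exact he'
  choose f hf using step
  have base : ∃ q, PP D 2 q := by
    obtain ⟨hpp, hxp⟩ := pr_spec ((2 : ℝ) ^ ((2 : ℝ) ^ D))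
    have h1 : 1 < (2 : ℝ) ^ ((2 : ℝ) ^ D) := Real.one_lt_rpow (by norm_num) (by positivity)
    set P := pr ((2 : ℝ) ^ ((2 : ℝ) ^ D))
    have hb : (1 : ℝ) < 2 := by norm_num
    obtain ⟨d', hd'⟩ := inv_aux _ hb (P : ℝ) (by linarith)
    obtain ⟨e', he'⟩ := inv_aux _ hb ((P : ℝ) + 1) (by linarith)
    refine ⟨(d', e'), ?_, ?_, P, hpp, ?_, ?_⟩
    · have : D < d' := by rw [← lt_aux _ hb, hd']; exact hxp
      exact this.le
    · change d' < e'
      rw [← lt_aux _ hb, hd', he']; linarith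
    · push_cast; exact hd'
    · push_cast; exact he'
  obtain ⟨q0, hq0⟩ := base
  let s : ℕ → ℝ × ℝ := fun k => Nat.rec q0 (fun k q => f (k + 2) q) k
  have hs : ∀ k, PP D (k + 2) (s k) := by
    intro k
    induction k with
    | zero => exact hq0
    | succ k ih => exact (hf (k + 2) (s k) (by omega) ih).1
  have hs2 : ∀ k, (s k).1 ≤ (s (k + 1)).1 ∧ (s (k + 1)).2 < (s k).2 := fun k =>
    (hf (k + 2) (s k) (by omega) (hs k)).2
  have hmono : Monotone (fun k => (s k).1) := monotone_nat_of_le_succ fun k => (hs2 k).1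
  have hanti : StrictAnti (fun k => (s k).2) := strictAnti_nat_of_succ_lt fun k => (hs2 k).2
  have hle : ∀ j k, (s j).1 ≤ (s k).2 := fun j k =>
    calc (s j).1 ≤ (s (max j k)).1 := hmono (le_max_left _ _)
      _ ≤ (s (max j k)).2 := (hs _).2.1.le
      _ ≤ _ := hanti.antitone (le_max_right _ _)
  have hbdd : BddAbove (Set.range fun k => (s k).1) :=
    ⟨(s 0).2, by rintro _ ⟨j, rfl⟩; exact hle j 0⟩
  set d := ⨆ k, (s k).1 with hd
  have hd1 : ∀ k, (s k).1 ≤ d := fun k => le_ciSup hbdd k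
  have hd2 : ∀ k, d < (s k).2 := fun k =>
    lt_of_le_of_lt (ciSup_le fun j => hle j (k + 1)) (hs2 k).2
  have hdD : D ≤ d := (hs 0).1.trans (hd1 0)
  refine ⟨d, by linarith, ?_, ?_⟩
  · intro n hn
    rcases Nat.lt_or_ge n 2 with h | h
    · have : n = 1 := by omega
      subst this
      have : ⌊(2 : ℝ) ^ (((1 : ℕ) : ℝ) ^ d)⌋ = 2 := by simp
      rw [this]
      exact Int.prime_two
    · obtain ⟨k, rfl⟩ := Nat.exists_eq_add_of_le' h
      obtain ⟨-, -, p, hp, hp1, hp2⟩ := hs k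
      have hb : (1 : ℝ) < ((k + 2 : ℕ) : ℝ) := by exact_mod_cast (by omega : 1 < k + 2)
      have : ⌊(2 : ℝ) ^ (((k + 2 : ℕ) : ℝ) ^ d)⌋ = (p : ℤ) := by
        rw [Int.floor_eq_iff]
        constructor
        · have := (le_aux _ hb _ _).2 (hd1 k)
          rw [hp1] at this
          exact_mod_cast this
        · have := (lt_aux _ hb _ _).2 (hd2 k)
          rw [hp2] at this
          exact_mod_cast this
      rw [this]
      exact Nat.prime_iff_prime_int.1 hp
  · intro n hn m hm hnm
    have hn' : 1 ≤ n := hn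
    have hn1 : (1 : ℝ) ≤ n := by exact_mod_cast hn'
    have hb := bern_aux n hn d (by linarith)
    have h1 : 1 ≤ (n : ℝ) ^ (d - 1) := Real.one_le_rpow hn1 (by linarith)
    have h2 : ((n : ℝ) + 1) ^ d ≤ (m : ℝ) ^ d :=
      Real.rpow_le_rpow (by linarith) (by exact_mod_cast hnm) (by linarith)
    have h3 : (n : ℝ) ^ d + 1 ≤ (m : ℝ) ^ d := by nlinarith
    have h4 := Real.rpow_le_rpow_of_exponent_le (by norm_num : (1 : ℝ) ≤ 2) h3
    rw [Real.rpow_add (by norm_num), Real.rpow_one] at h4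
    have h5 : 1 ≤ (2 : ℝ) ^ ((n : ℝ) ^ d) := Real.one_le_rpow (by norm_num) (by positivity)
    have h6 : (2 : ℝ) ^ ((n : ℝ) ^ d) + 1 ≤ (2 : ℝ) ^ ((m : ℝ) ^ d) := by linarith
    have h7 := Int.floor_le_floor h6
    rw [Int.floor_add_one] at h7
    change ⌊(2 : ℝ) ^ ((n : ℝ) ^ d)⌋ < ⌊(2 : ℝ) ^ ((m : ℝ) ^ d)⌋
    omega
end

section
/- Let d > 1 be a real number, n ≥ 1 an integer, and let c, c' be real numbers with 2 ≤ c ≤ c'. Set g = c'^{(n+1)^d} − c^{(n+1)^d}. Then c'^{n^d} − c^{n^d} ≤ (n/(n+1))^d · g / c^{(n+1)^d − n^d}. -/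
open Real

theorem stmt_9 (d : ℝ) (hd : 1 < d) (n : ℕ) (hn : 1 ≤ n)
    (c c' : ℝ) (hc : 2 ≤ c) (hcc' : c ≤ c')
    (g : ℝ) (hg : g = c' ^ (((n : ℝ) + 1) ^ d) - c ^ (((n : ℝ) + 1) ^ d)) :
    c' ^ ((n : ℝ) ^ d) - c ^ ((n : ℝ) ^ d) ≤
      ((n : ℝ) / ((n : ℝ) + 1)) ^ d * g / c ^ ((((n : ℝ) + 1) ^ d) - (n : ℝ) ^ d) := by
  have hn0 : (0 : ℝ) < n := by exact_mod_cast hn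
  have hc0 : 0 < c := by linarith
  have hc0' : 0 < c' := by linarith
  rw [Real.div_rpow hn0.le (by positivity), Real.rpow_sub hc0, hg]
  have ha : 0 < (n : ℝ) ^ d := by positivity
  have hab : (n : ℝ) ^ d ≤ ((n : ℝ) + 1) ^ d :=
    Real.rpow_le_rpow hn0.le (by linarith) (by linarith)
  generalize (n : ℝ) ^ d = a at *
  generalize ((n : ℝ) + 1) ^ d = b at *
  have hb : 0 < b := by linarith
  have hx : 0 < c ^ a := by positivity
  have hy : 0 < c' ^ a := by positivity
  have hB : 0 < c ^ b := by positivity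
  have key := one_add_mul_self_le_rpow_one_add (s := c' ^ a / c ^ a - 1) (p := b / a)
    (by have : 0 < c' ^ a / c ^ a := by positivity
        linarith) ((one_le_div ha).2 hab)
  have e : a * (b / a) = b := by field_simp
  rw [add_sub_cancel, Real.div_rpow hy.le hx.le, ← Real.rpow_mul hc0'.le,
    ← Real.rpow_mul hc0.le, e] at key
  have h2 : c' ^ a - c ^ a = a / b * c ^ a * (b / a * (c' ^ a / c ^ a - 1)) := by
    field_simp
  have h3 : a / b * (c' ^ b - c ^ b) / (c ^ b / c ^ a)
      = a / b * c ^ a * (c' ^ b / c ^ b - 1) := by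
    field_simp
  rw [h2, h3]
  apply mul_le_mul_of_nonneg_left _ (by positivity)
  linarith
end

section
/- Let d > 1 be a real number, n ≥ 1 an integer, k an integer with 1 ≤ k ≤ n, and let c, c' be real numbers with 2 ≤ c ≤ c'. Set g = c'^{(n+1)^d} − c^{(n+1)^d}. Then c'^{k^d} − c^{k^d} ≤ (k/(n+1))^d · g / c^{(n+1)^d − k^d}. -/
open Real

theorem stmt_10 (d : ℝ) (hd : 1 < d) (n k : ℕ) (hn : 1 ≤ n) (hk1 : 1 ≤ k) (hkn : k ≤ n)
    (c c' : ℝ) (hc : 2 ≤ c) (hcc' : c ≤ c')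
    (g : ℝ) (hg : g = c' ^ (((n : ℝ) + 1) ^ d) - c ^ (((n : ℝ) + 1) ^ d)) :
    c' ^ ((k : ℝ) ^ d) - c ^ ((k : ℝ) ^ d) ≤
      ((k : ℝ) / ((n : ℝ) + 1)) ^ d * g / c ^ ((((n : ℝ) + 1) ^ d) - (k : ℝ) ^ d) := by
  have hk0 : (0 : ℝ) < k := by exact_mod_cast hk1
  have hkn' : (k : ℝ) ≤ (n : ℝ) + 1 := by exact_mod_cast Nat.le_succ_of_le hkn
  have hn0 : (0 : ℝ) < (n : ℝ) + 1 := by positivity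
  rw [Real.div_rpow hk0.le hn0.le, hg]
  have ha : 0 < (k : ℝ) ^ d := by positivity
  have hb : 0 < ((n : ℝ) + 1) ^ d := by positivity
  have hab : (k : ℝ) ^ d ≤ ((n : ℝ) + 1) ^ d :=
    Real.rpow_le_rpow hk0.le hkn' (by linarith)
  generalize (k : ℝ) ^ d = a at *
  generalize ((n : ℝ) + 1) ^ d = b at *
  have hc0 : 0 < c := by linarith
  obtain ⟨t, rfl⟩ : ∃ t, c' = t * c := ⟨c' / c, by field_simp⟩
  have ht : 1 ≤ t := by
    by_contra h
    push Not at h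
    nlinarith
  have ht0 : 0 ≤ t := by linarith
  have key := rpow_one_add_le_one_add_mul_self (s := t ^ b - 1) (p := a / b)
    (by have := Real.rpow_nonneg ht0 b; linarith) (by positivity) ((div_le_one hb).2 hab)
  have e : (1 + (t ^ b - 1)) ^ (a / b) = t ^ a := by
    rw [add_sub_cancel, ← Real.rpow_mul ht0, mul_div_cancel₀ _ hb.ne']
  rw [e] at key
  rw [Real.mul_rpow ht0 hc0.le, Real.mul_rpow ht0 hc0.le, Real.rpow_sub hc0]
  have hca : 0 < c ^ a := by positivity
  have hcb : 0 < c ^ b := by positivity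
  have e2 : a / b * (t ^ b * c ^ b - c ^ b) / (c ^ b / c ^ a) = a / b * (t ^ b - 1) * c ^ a := by
    field_simp
  rw [e2]
  nlinarith
end

section
/- Let d > 1 be a real number, n ≥ 1 an integer, k an integer with 1 ≤ k ≤ n, and let c, c' be real numbers with 2 ≤ c ≤ c'. Set g = c'^{(n+1)^d} − c^{(n+1)^d}. If the fractional part of c^{k^d} satisfies frac(c^{k^d}) < 1 − (k/(n+1))^d · g / c^{(n+1)^d − k^d}, then ⌊c'^{k^d}⌋ = ⌊c^{k^d}⌋. -/
open Real

theorem stmt_11 (d : ℝ) (hd : 1 < d) (n k : ℕ) (hn : 1 ≤ n) (hk1 : 1 ≤ k) (hkn : k ≤ n)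
    (c c' : ℝ) (hc : 2 ≤ c) (hcc' : c ≤ c')
    (g : ℝ) (hg : g = c' ^ (((n : ℝ) + 1) ^ d) - c ^ (((n : ℝ) + 1) ^ d))
    (hfrac : Int.fract (c ^ ((k : ℝ) ^ d)) <
      1 - ((k : ℝ) / ((n : ℝ) + 1)) ^ d * g / c ^ ((((n : ℝ) + 1) ^ d) - (k : ℝ) ^ d)) :
    ⌊c' ^ ((k : ℝ) ^ d)⌋ = ⌊c ^ ((k : ℝ) ^ d)⌋ := by
  have hk0 : (0 : ℝ) < k := by exact_mod_cast hk1
  have hkn' : (k : ℝ) ≤ (n : ℝ) + 1 := by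
    have : (k : ℝ) ≤ n := by exact_mod_cast hkn
    linarith
  have hn0 : (0 : ℝ) < (n : ℝ) + 1 := by positivity
  rw [Real.div_rpow hk0.le hn0.le] at hfrac
  have ha : 0 < (k : ℝ) ^ d := Real.rpow_pos_of_pos hk0 d
  have hb : 0 < ((n : ℝ) + 1) ^ d := Real.rpow_pos_of_pos hn0 d
  have hab : (k : ℝ) ^ d ≤ ((n : ℝ) + 1) ^ d :=
    Real.rpow_le_rpow hk0.le hkn' (by linarith)
  generalize (k : ℝ) ^ d = a at *
  generalize ((n : ℝ) + 1) ^ d = b at *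
  have hc0 : 0 < c := by linarith
  have hc0' : 0 < c' := by linarith
  have hA : 0 < c ^ a := Real.rpow_pos_of_pos hc0 a
  have hB : 0 < c ^ b := Real.rpow_pos_of_pos hc0 b
  have hB' : 0 < c' ^ b := Real.rpow_pos_of_pos hc0' b
  have hle : c ^ a ≤ c' ^ a := Real.rpow_le_rpow hc0.le hcc' ha.le
  have hber : (c' / c) ^ a ≤ 1 + a / b * ((c' / c) ^ b - 1) := by
    have h0 : 0 < (c' / c) ^ b := Real.rpow_pos_of_pos (by positivity) b
    have h := rpow_one_add_le_one_add_mul_self (s := (c' / c) ^ b - 1) (by linarith)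
      (p := a / b) (by positivity) (by rw [div_le_one hb]; exact hab)
    rw [add_sub_cancel, ← Real.rpow_mul (by positivity), mul_div_cancel₀ _ hb.ne'] at h
    exact h
  rw [Real.div_rpow hc0'.le hc0.le, Real.div_rpow hc0'.le hc0.le] at hber
  rw [Real.rpow_sub hc0] at hfrac
  have hkey : c' ^ a ≤ c ^ a + a / b * g / (c ^ b / c ^ a) := by
    rw [div_le_iff₀ hA] at hber
    refine hber.trans (le_of_eq ?_)
    rw [hg]
    field_simp
  have hf := Int.floor_add_fract (c ^ a)
  rw [Int.floor_eq_iff]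
  have := Int.floor_le (c ^ a)
  constructor <;> linarith
end

section
/- Let d > 1 be a real number, n ≥ 1 and j ≥ 1 integers, and let b_0 ≤ b_1 ≤ ... ≤ b_j be real numbers with b_0 ≥ 2. For i = 1, ..., j set g_i = b_i^{(n+i)^d} − b_{i−1}^{(n+i)^d}. Then for every integer k with 1 ≤ k ≤ n, b_j^{k^d} − b_0^{k^d} ≤ ∑_{i=1}^{j} (k/(n+i))^d · g_i / b_{i−1}^{(n+i)^d − k^d}. -/
open Real

theorem stmt_12_aux (x y p q : ℝ) (hx : 0 < x) (hxy : x ≤ y) (hp : 0 < p) (hpq : p ≤ q) :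
    y ^ p - x ^ p ≤ p / q * (y ^ q - x ^ q) / x ^ (q - p) := by
  have hq : 0 < q := hp.trans_le hpq
  have hy : 0 < y := hx.trans_le hxy
  have hxq : 0 < x ^ q := rpow_pos_of_pos hx q
  have hxp : 0 < x ^ p := rpow_pos_of_pos hx p
  have hyq : 0 < y ^ q := rpow_pos_of_pos hy q
  have h := rpow_one_add_le_one_add_mul_self (s := y ^ q / x ^ q - 1) (p := p / q)
    (by have := div_pos hyq hxq; linarith) (by positivity) ((div_le_one hq).2 hpq)
  have e : (1 + (y ^ q / x ^ q - 1)) ^ (p / q) = y ^ p / x ^ p := by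
    rw [add_sub_cancel, div_rpow hyq.le hxq.le, ← rpow_mul hy.le, ← rpow_mul hx.le,
      mul_div_cancel₀ _ hq.ne']
  rw [e, div_le_iff₀ hxp] at h
  have e2 : p / q * (y ^ q - x ^ q) / x ^ (q - p)
      = (p / q * (y ^ q / x ^ q - 1)) * x ^ p := by
    rw [rpow_sub hx]
    field_simp
  rw [e2]
  linarith

theorem stmt_12 (d : ℝ) (hd : 1 < d) (n j : ℕ) (hn : 1 ≤ n) (hj : 1 ≤ j)
    (b : ℕ → ℝ) (hb0 : 2 ≤ b 0) (hbmono : ∀ i : ℕ, i < j → b i ≤ b (i + 1)) :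
    ∀ k : ℕ, 1 ≤ k → k ≤ n →
      b j ^ ((k : ℝ) ^ d) - b 0 ^ ((k : ℝ) ^ d) ≤
        ∑ i ∈ Finset.Icc 1 j,
          ((k : ℝ) / ((n : ℝ) + i)) ^ d *
            (b i ^ (((n : ℝ) + i) ^ d) - b (i - 1) ^ (((n : ℝ) + i) ^ d)) /
            (b (i - 1)) ^ ((((n : ℝ) + i) ^ d) - (k : ℝ) ^ d) := by
  intro k hk hkn
  clear hj
  have hk' : (0 : ℝ) < k := by exact_mod_cast hk
  have hkn' : (k : ℝ) ≤ n := by exact_mod_cast hkn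
  suffices H : 2 ≤ b j ∧ _ from H.2
  induction j with
  | zero => simpa using hb0
  | succ m ih =>
    obtain ⟨h2, ih⟩ := ih (fun i hi => hbmono i (by omega))
    have hm := hbmono m (by omega)
    refine ⟨h2.trans hm, ?_⟩
    rw [Finset.sum_Icc_succ_top (by omega)]
    have hnm : (k : ℝ) ≤ (n : ℝ) + ((m + 1 : ℕ) : ℝ) := by
      have : (0 : ℝ) ≤ ((m + 1 : ℕ) : ℝ) := Nat.cast_nonneg _
      linarith
    have h := stmt_12_aux (b m) (b (m + 1)) ((k : ℝ) ^ d) (((n : ℝ) + ((m + 1 : ℕ) : ℝ)) ^ d)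
      (by linarith) hm (rpow_pos_of_pos hk' d) (rpow_le_rpow hk'.le hnm (by linarith))
    rw [← div_rpow hk'.le (hk'.le.trans hnm)] at h
    rw [Nat.add_sub_cancel]
    linarith
end

section
/- Let d > 1 be a real number, n ≥ 1 an integer, c ≥ 2 a real number, and H > 0 a constant such that pr(x) − x < H·(ln x)² for every real x ≥ 2. Let p = pr(c^{(n+1)^d}) and c' = p^{1/(n+1)^d}. Then c'^{n^d} − c^{n^d} < H · n^d · (n+1)^d · (ln c)² / c^{(n+1)^d − n^d}. -/
open Real

theorem stmt_13 (d : ℝ) (hd : 1 < d) (n : ℕ) (hn : 1 ≤ n)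
    (c : ℝ) (hc : 2 ≤ c) (H : ℝ) (hH : 0 < H)
    (hCramer : ∀ x : ℝ, 2 ≤ x → (pr x : ℝ) - x < H * (Real.log x) ^ 2)
    (p : ℕ) (hp : p = pr (c ^ (((n : ℝ) + 1) ^ d)))
    (c' : ℝ) (hc' : c' = (p : ℝ) ^ (1 / (((n : ℝ) + 1) ^ d))) :
    c' ^ ((n : ℝ) ^ d) - c ^ ((n : ℝ) ^ d) <
      H * (n : ℝ) ^ d * ((n : ℝ) + 1) ^ d * (Real.log c) ^ 2 /
        c ^ ((((n : ℝ) + 1) ^ d) - (n : ℝ) ^ d) := by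
  have hn0 : (0 : ℝ) < n := by exact_mod_cast hn
  have hc0 : (0 : ℝ) < c := by linarith
  have ha : 0 < (n : ℝ) ^ d := Real.rpow_pos_of_pos hn0 d
  have hab : (n : ℝ) ^ d ≤ ((n : ℝ) + 1) ^ d :=
    Real.rpow_le_rpow hn0.le (by linarith) (by linarith)
  have hb1 : 1 ≤ ((n : ℝ) + 1) ^ d := Real.one_le_rpow (by linarith) (by linarith)
  generalize (n : ℝ) ^ d = a at *
  generalize ((n : ℝ) + 1) ^ d = b at *
  have hb : 0 < b := by linarith
  have hx : 0 < c ^ b := Real.rpow_pos_of_pos hc0 b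
  have hx2 : 2 ≤ c ^ b := hc.trans (Real.self_le_rpow_of_one_le (by linarith) hb1)
  have hC := hCramer _ hx2
  rw [← hp, Real.log_rpow hc0] at hC
  have hp0 : (0 : ℝ) ≤ p := Nat.cast_nonneg p
  have hB := rpow_one_add_le_one_add_mul_self (s := (p : ℝ) / c ^ b - 1) (p := a / b)
    (by have : 0 ≤ (p : ℝ) / c ^ b := by positivity
        linarith) (by positivity) ((div_le_one hb).2 hab)
  have hca : 0 < c ^ a := Real.rpow_pos_of_pos hc0 a
  have e1 : c' ^ a = c ^ a * (1 + ((p : ℝ) / c ^ b - 1)) ^ (a / b) := by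
    rw [add_sub_cancel, Real.div_rpow hp0 hx.le, ← Real.rpow_mul hc0.le,
      mul_div_cancel₀ _ hb.ne', hc', ← Real.rpow_mul hp0, one_div_mul_eq_div]
    field_simp
  have e2 : H * a * b * (Real.log c) ^ 2 / c ^ (b - a)
      = c ^ a * (a / b) / c ^ b * (H * (b * Real.log c) ^ 2) := by
    rw [Real.rpow_sub hc0]
    field_simp
  have h1 := mul_le_mul_of_nonneg_left hB hca.le
  have h2 := mul_lt_mul_of_pos_left hC (show 0 < c ^ a * (a / b) / c ^ b by positivity)
  have e3 : c ^ a * (1 + a / b * ((p : ℝ) / c ^ b - 1)) - c ^ a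
      = c ^ a * (a / b) / c ^ b * ((p : ℝ) - c ^ b) := by
    field_simp
    ring
  rw [e1, e2]
  linarith
end

section
/- Let c ≥ 2 and m ≥ 1 be real numbers, let H > 0, and let p be a prime number with c^m < p < c^m + H·m²·(ln c)². Then p^{1/m} < c + H·m·c·(ln c)² / c^m. -/
open Real

theorem stmt_16 (c m H : ℝ) (hc : 2 ≤ c) (hm : 1 ≤ m) (hH : 0 < H)
    (p : ℕ) (hp : p.Prime)
    (hlb : c ^ m < (p : ℝ)) (hub : (p : ℝ) < c ^ m + H * m ^ 2 * (Real.log c) ^ 2) :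
    (p : ℝ) ^ (1 / m) < c + H * m * c * (Real.log c) ^ 2 / c ^ m := by
  have hc0 : 0 < c := by linarith
  have hm0 : 0 < m := by linarith
  have hcm : 0 < c ^ m := Real.rpow_pos_of_pos hc0 m
  obtain ⟨s, hs⟩ : ∃ s, s = H * m * (Real.log c) ^ 2 / c ^ m := ⟨_, rfl⟩
  have hs0 : 0 ≤ s := by rw [hs]; positivity
  have e1 : c + H * m * c * (Real.log c) ^ 2 / c ^ m = c * (1 + s) := by
    rw [hs]; ring
  have e2 : c ^ m * s = H * m * (Real.log c) ^ 2 := by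
    rw [hs]; exact mul_div_cancel₀ _ hcm.ne'
  have hb := one_add_mul_self_le_rpow_one_add (by linarith : -1 ≤ s) hm
  have h1 : (p : ℝ) < (c * (1 + s)) ^ m := by
    rw [Real.mul_rpow hc0.le (by linarith)]
    have h2 := mul_le_mul_of_nonneg_left hb hcm.le
    have h3 : c ^ m * (1 + m * s) = c ^ m + H * m ^ 2 * (Real.log c) ^ 2 := by
      linear_combination m * e2
    linarith
  rw [e1]
  have h4 := Real.rpow_lt_rpow (Nat.cast_nonneg p) h1 (by positivity : 0 < 1 / m)
  rwa [← Real.rpow_mul (by positivity), mul_one_div_cancel hm0.ne', Real.rpow_one] at h4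
end
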